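/- (Schilling's Theorem for p-groups) Let ψ be a 𝕂G-irrep and let 𝕃 be a field extension of 𝕂. Then every irreducible 𝕃G-constituent of 𝕃 ⊗_𝕂 ψ occurs with multiplicity at most 2. Moreover, if some irreducible constituent of 𝕃 ⊗_𝕂 ψ has multiplicity 2, then any irreducible ℂG-representation quasiconjugate to ψ has Frobenius–Schur indicator equal to −1. -/

import Mathlib

open scoped Classical

noncomputable section

namespace Genotype

variable {k : Type} [Field k] {G : Type} [Group G]

/-- The subfield generated (over the prime field `ℚ`) by the values of a function,
e.g. the field `ℚ[ψ]` generated by the values of a character. -/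
def charField {X : Type} {k : Type} [Field k] (f : X → k) : Subfield k :=
  Subfield.closure (Set.range f)

theorem mem_charField {X : Type} {k : Type} [Field k] (f : X → k) (x : X) :
    f x ∈ charField f :=
  Subfield.subset_closure ⟨x, rfl⟩

/-- Two functions (typically characters of irreps over possibly different
characteristic-zero fields) are Galois conjugate: there is a Galois extension `M` of `ℚ`
containing (copies of) all their values and a field automorphism `α` of `M` with
`α (f g) = f' g` for all `g`. -/
def IsGaloisConj {k l : Type} [Field k] [Field l] {G : Type}
    (f : G → k) (f' : G → l) : Prop :=
  ∃ (M : Type) (_ : Field M) (_ : Algebra ℚ M), IsGalois ℚ M ∧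
    ∃ (i : charField f →+* M) (j : charField f' →+* M) (α : M ≃+* M),
      ∀ g : G, α (i ⟨f g, mem_charField f g⟩) = j ⟨f' g, mem_charField f' g⟩

/-- Irreducibility of a finite-dimensional representation. -/
def IsIrr (V : FDRep k G) : Prop :=
  Nontrivial V ∧
    ∀ U : Submodule k V, (∀ g : G, ∀ x ∈ U, V.ρ g x ∈ U) → U = ⊥ ∨ U = ⊤

/-- Faithfulness of a representation. -/
def IsFaithfulRep (V : FDRep k G) : Prop := Function.Injective V.ρ

/-- `f` (the character of an irrep) occurs in the character `c`,
i.e. `c = f + (character of some representation)`. -/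
def CharOccurs (f c : G → k) : Prop :=
  ∃ W : FDRep k G, c = f + W.character

/-- `f` (the character of an irrep) occurs in `c` with multiplicity exactly `m`. -/
def CharMult (f c : G → k) (m : ℕ) : Prop :=
  ∃ W : FDRep k G, c = m • f + W.character ∧ ¬ CharOccurs f W.character

/-- `f` is the character of an irreducible representation. -/
def IsIrrChar (f : G → k) : Prop := ∃ V : FDRep k G, IsIrr V ∧ f = V.character

/-- Restriction of a character to a subgroup. -/
def resChar (H : Subgroup G) (c : G → k) : H → k := fun h => c h

/-- The induced character `ind_H^G f`. -/
def indChar (H : Subgroup G) (f : H → k) : G → k := fun g =>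
  (Nat.card H : k)⁻¹ *
    ∑ᶠ x : G, if h : x⁻¹ * g * x ∈ H then f ⟨x⁻¹ * g * x, h⟩ else 0

/-- The character `cψ` (of a `kG`-irrep) is tightly induced from the character `cφ`
(of a `kH`-irrep): `cψ` is the induced character of `cφ`, `cφ` occurs with multiplicity
exactly `1` in the restriction of `cψ`, and no Galois conjugate of `cφ` other than `cφ`
itself occurs in the restriction of `cψ`. -/
def TightInd (H : Subgroup G) (cψ : G → k) (cφ : H → k) : Prop :=
  cψ = indChar H cφ ∧ CharMult cφ (resChar H cψ) 1 ∧
    ∀ cφ' : H → k, IsIrrChar cφ' → IsGaloisConj cφ cφ' →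
      CharOccurs cφ' (resChar H cψ) → cφ' = cφ

/-- Tight induction from a subquotient `H/K` of `G`: tight induction from `H`
of the inflation. -/
def TightIndSub (H : Subgroup G) (K : Subgroup H) [K.Normal]
    (cψ : G → k) (cφ : (H ⧸ K) → k) : Prop :=
  TightInd H cψ (fun h => cφ (QuotientGroup.mk h))

/-- A group is Roquette if every normal abelian subgroup of it is cyclic. -/
def IsRoquette (P : Type) [Group P] : Prop :=
  ∀ A : Subgroup P, A.Normal → (∀ x ∈ A, ∀ y ∈ A, x * y = y * x) → IsCyclic A

/-- `χ` is the rational form `ψ_ℚ` of `V`: a rational irrep such that `V` occurs in the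
scalar extension `k ⊗_ℚ χ`. -/
def IsRatForm [CharZero k] (χ : FDRep ℚ G) (V : FDRep k G) : Prop :=
  IsIrr χ ∧ CharOccurs V.character (fun g => algebraMap ℚ k (χ.character g))

/-- Irreps over possibly different characteristic-zero fields are quasiconjugate if they
determine the same rational irrep. -/
def Quasiconj {k l : Type} [Field k] [Field l] [CharZero k] [CharZero l] {G : Type} [Group G]
    (V : FDRep k G) (W : FDRep l G) : Prop :=
  ∃ χ : FDRep ℚ G, IsRatForm χ V ∧ IsRatForm χ W

end Genotype

namespace Genotype


lemma rel_central {p : ℕ} [Fact p.Prime] {G : Type} [Group G] [Finite G] (hG : IsPGroup p G)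
    (Z N : Subgroup G) [hZ : Z.Normal] [hN : N.Normal] (h : ¬ N ≤ Z) :
    ∃ y ∈ N, y ∉ Z ∧ ∀ g : G, g * y * g⁻¹ * y⁻¹ ∈ Z := by
  let M : Subgroup (G ⧸ Z) := N.map (QuotientGroup.mk' Z)
  have hM : M.Normal := hN.map _ (QuotientGroup.mk'_surjective Z)
  let : MulAction (G ⧸ Z) M := MulAction.compHom M (MulAut.conjNormal (H := M))
  have hQ : IsPGroup p (G ⧸ Z) := hG.to_quotient Z
  have hMne : M ≠ ⊥ := by
    intro hb
    apply h
    have := (Subgroup.map_eq_bot_iff N).1 hb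
    rwa [QuotientGroup.ker_mk'] at this
  have hcard : p ∣ Nat.card M := by
    rcases (hQ.to_subgroup M).card_eq_or_dvd with h1 | h1
    · exact absurd ((Subgroup.card_eq_one).1 h1) hMne
    · exact h1
  have h1 : (1 : M) ∈ MulAction.fixedPoints (G ⧸ Z) M := by
    intro g
    exact map_one (MulAut.conjNormal (H := M) g)
  obtain ⟨b, hb, hb1⟩ := hQ.exists_fixed_point_of_prime_dvd_card_of_fixed_point M hcard h1
  obtain ⟨y, hy, hyb⟩ := b.2
  refine ⟨y, hy, ?_, ?_⟩
  · intro hyZ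
    apply hb1
    ext
    rw [← hyb]
    simpa using ((QuotientGroup.eq_one_iff y).2 hyZ).symm
  · intro g
    have := congrArg Subtype.val (hb (g : G ⧸ Z))
    have h2 : ((g : G ⧸ Z)) * (b : G ⧸ Z) * (g : G ⧸ Z)⁻¹ = b := this
    rw [← hyb] at h2
    rw [← QuotientGroup.eq_one_iff]
    simp only [QuotientGroup.mk'_apply] at h2
    change (g : G ⧸ Z) * (y : G ⧸ Z) * (g : G ⧸ Z)⁻¹ * (y : G ⧸ Z)⁻¹ = 1
    rw [h2]; simp

lemma exists_maxab {p : ℕ} [Fact p.Prime] {G : Type} [Group G] [Finite G] (hG : IsPGroup p G) :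
    ∃ A : Subgroup G, A.Normal ∧ (∀ x ∈ A, ∀ y ∈ A, x * y = y * x) ∧
      ∀ g : G, (∀ x ∈ A, g * x = x * g) → g ∈ A := by
  obtain ⟨A, hA⟩ := Set.Finite.exists_maximal
    (s := {A : Subgroup G | A.Normal ∧ (∀ x ∈ A, ∀ y ∈ A, x * y = y * x)}) (Set.toFinite _)
    ⟨⊥, inferInstance, by simp⟩
  obtain ⟨hn, hc⟩ := hA.prop
  refine ⟨A, hn, hc, ?_⟩
  by_contra! hcon
  obtain ⟨g, hg, hgA⟩ := hcon
  have hgC : g ∈ Subgroup.centralizer (A : Set G) := by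
    rw [Subgroup.mem_centralizer_iff]; intro x hx; exact (hg x hx).symm
  obtain ⟨y, hyC, hyA, hy⟩ := rel_central hG A (Subgroup.centralizer (A : Set G)) (fun h => hgA (h hgC))
  rw [Subgroup.mem_centralizer_iff] at hyC
  have hcomm : ∀ x ∈ insert y (A : Set G), ∀ x' ∈ insert y (A : Set G), x * x' = x' * x := by
    rintro x (rfl | hx) x' (rfl | hx')
    · rfl
    · exact (hyC x' hx').symm
    · exact (hyC x hx)
    · exact hc x hx x' hx'
  let B := Subgroup.closure (insert y (A : Set G))
  have hAB : A ≤ B := fun x hx => Subgroup.subset_closure (Set.mem_insert_of_mem _ hx)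
  have hyB : y ∈ B := Subgroup.subset_closure (Set.mem_insert _ _)
  have hBc : ∀ x ∈ B, ∀ x' ∈ B, x * x' = x' * x := by
    intro x hx x' hx'
    have hle : B ≤ Subgroup.centralizer (B : Set G) := by
      have h1 : B ≤ Subgroup.centralizer (insert y (A : Set G)) := by
        rw [Subgroup.closure_le]
        intro a ha
        rw [SetLike.mem_coe, Subgroup.mem_centralizer_iff]
        intro b hb; exact hcomm b hb a ha
      have h2 : insert y (A : Set G) ⊆ Subgroup.centralizer (B : Set G) := by
        intro a ha
        rw [SetLike.mem_coe, Subgroup.mem_centralizer_iff]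
        intro b hb
        exact (Subgroup.mem_centralizer_iff.1 (h1 hb) a ha).symm
      exact (Subgroup.closure_le _).2 h2
    exact (Subgroup.mem_centralizer_iff.1 (hle hx) x' hx').symm
  have hBn : B.Normal := by
    constructor
    intro x hx g
    have : B ≤ B.comap (MulAut.conj g).toMonoidHom := by
      rw [Subgroup.closure_le]
      rintro a (rfl | ha)
      · change g * a * g⁻¹ ∈ B
        have := B.mul_mem (hAB (hy g)) hyB
        simpa using this
      · change g * a * g⁻¹ ∈ B
        exact hAB (hn.conj_mem a ha g)
    exact this hx
  exact hyA (hA.le_of_ge ⟨hBn, hBc⟩ hAB hyB)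

lemma cyclic_of {p : ℕ} [Fact p.Prime] {A : Type} [CommGroup A] [Finite A] (hA : IsPGroup p A)
    (h : Nat.card (powMonoidHom p : A →* A).ker ≤ p) : IsCyclic A := by
  have key : ∀ k : ℕ, Nat.card (powMonoidHom (p ^ k) : A →* A).ker ≤ p ^ k := by
    intro k
    induction k with
    | zero =>
      have : (powMonoidHom (p ^ 0) : A →* A).ker = ⊥ := by
        ext x; simp [MonoidHom.mem_ker]
      rw [this]; simp
    | succ k ih =>
      let f : (powMonoidHom (p ^ (k+1)) : A →* A).ker →* (powMonoidHom (p ^ k) : A →* A).ker :=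
        ((powMonoidHom p : A →* A).comp (Subgroup.subtype _)).codRestrict _ (by
          rintro ⟨x, hx⟩
          rw [MonoidHom.mem_ker] at hx ⊢
          simpa [← pow_mul, pow_succ'] using hx)
      have h1 : Nat.card f.ker ≤ p := by
        refine le_trans ?_ h
        let g : f.ker → (powMonoidHom p : A →* A).ker := fun x => ⟨x.1.1, by
          have := x.2
          rw [MonoidHom.mem_ker] at this
          have h2 := congrArg Subtype.val this
          rw [MonoidHom.mem_ker]
          exact h2⟩
        apply Nat.card_le_card_of_injective g
        intro x y hxy
        have := congrArg Subtype.val hxy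
        exact Subtype.ext (Subtype.ext this)
      have h2 := Subgroup.card_mul_index f.ker
      rw [Subgroup.index_ker] at h2
      have h3 : Nat.card f.range ≤ Nat.card (powMonoidHom (p ^ k) : A →* A).ker :=
        Subgroup.card_le_card_group _
      refine h2.symm.le.trans ?_
      exact (Nat.mul_le_mul h1 (h3.trans ih)).trans (pow_succ' p k).symm.le
  classical
  have := Fintype.ofFinite A
  apply isCyclic_of_card_pow_eq_one_le
  intro n hn
  obtain ⟨m, hm⟩ := IsPGroup.iff_card.1 hA
  obtain ⟨k, -, hk⟩ := (Nat.dvd_prime_pow (Fact.out : p.Prime)).1 (hm ▸ Nat.gcd_dvd_right n (Nat.card A))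
  have h1 : (Finset.univ.filter fun a : A => a ^ n = 1).card ≤ Nat.card (powMonoidHom (p ^ k) : A →* A).ker := by
    have h0 := Nat.card_eq_card_toFinset (s := ((powMonoidHom (p ^ k) : A →* A).ker : Set A))
    refine le_trans ?_ h0.symm.le
    apply Finset.card_le_card
    intro a ha
    simp only [Finset.mem_filter, Finset.mem_univ, true_and] at ha
    simp only [Set.mem_toFinset, SetLike.mem_coe, MonoidHom.mem_ker, powMonoidHom_apply]
    rw [← hk, ← hm]
    exact pow_gcd_eq_one.2 ⟨ha, pow_card_eq_one'⟩
  refine h1.trans ((key k).trans ?_)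
  rw [← hk]; exact Nat.gcd_le_left _ hn

def HasPair (p : ℕ) (G : Type) [Group G] : Prop :=
  ∃ z y : G, z ∈ Subgroup.center G ∧ orderOf z = p ∧ y ^ p = 1 ∧ y ∉ Subgroup.zpowers z ∧
    ∀ g : G, g * y * g⁻¹ * y⁻¹ ∈ Subgroup.zpowers z

lemma cyc_struct {p : ℕ} [Fact p.Prime] {G : Type} [Group G] [Finite G] (hG : IsPGroup p G)
    (hP : ¬ HasPair p G) (hnc : ¬ ∀ x y : G, x * y = y * x) :
    ∃ (a : G) (n : ℕ), 1 ≤ n ∧ orderOf a = p ^ n ∧ (∀ g, g * a * g⁻¹ ∈ Subgroup.zpowers a) ∧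
      (∀ g, g * a = a * g → g ∈ Subgroup.zpowers a) ∧ a ^ p ^ (n-1) ∈ Subgroup.center G := by
  have hp : p.Prime := Fact.out
  obtain ⟨A, hAn, hAc, hAC⟩ := exists_maxab hG
  let N : Subgroup G :=
    { carrier := {y | y ∈ A ∧ y ^ p = 1}
      one_mem' := ⟨A.one_mem, one_pow _⟩
      mul_mem' := by
        rintro x y ⟨hx, hx1⟩ ⟨hy, hy1⟩
        refine ⟨A.mul_mem hx hy, ?_⟩
        rw [(show Commute x y from hAc x hx y hy).mul_pow, hx1, hy1, one_mul]
      inv_mem' := by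
        rintro x ⟨hx, hx1⟩
        exact ⟨A.inv_mem hx, by rw [inv_pow, hx1, inv_one]⟩ }
  have hNn : N.Normal := by
    constructor
    rintro x ⟨hx, hx1⟩ g
    refine ⟨hAn.conj_mem x hx g, ?_⟩
    rw [conj_pow, hx1]; simp
  have hAb : ¬ A ≤ ⊥ := by
    intro hb
    apply hnc
    have : ∀ g, g = (1 : G) := fun g => by
      have := hb (hAC g (fun x hx => by rw [Subgroup.mem_bot.1 (hb hx)]; simp))
      simpa using this
    intro x y; rw [this x, this y]
  have hNb : ¬ N ≤ ⊥ := by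
    intro hb
    apply hAb
    intro x hx
    by_contra hx1
    obtain ⟨k, hk⟩ := (IsPGroup.iff_orderOf.1 hG) x
    have hk0 : k ≠ 0 := by
      rintro rfl
      rw [pow_zero, orderOf_eq_one_iff] at hk
      exact hx1 (by simpa using hk)
    obtain ⟨j, rfl⟩ := Nat.exists_eq_succ_of_ne_zero hk0
    have : x ^ p ^ j ∈ N := ⟨A.pow_mem hx _, by rw [← pow_mul, ← pow_succ, ← hk, pow_orderOf_eq_one]⟩
    have h2 := Subgroup.mem_bot.1 (hb this)
    have h3 := orderOf_dvd_of_pow_eq_one h2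
    rw [hk] at h3
    exact absurd (Nat.le_of_dvd (pow_pos hp.pos _) h3) (not_le.2 (Nat.pow_lt_pow_succ hp.one_lt))
  obtain ⟨z, hzN, hz1, hzc⟩ := rel_central hG ⊥ N hNb
  have hz1' : z ≠ 1 := fun h => hz1 (by simp [h])
  have hzc' : z ∈ Subgroup.center G := by
    rw [Subgroup.mem_center_iff]
    intro g
    have := Subgroup.mem_bot.1 (hzc g)
    exact mul_inv_eq_iff_eq_mul.1 (mul_inv_eq_one.1 this)
  have hzo : orderOf z = p := orderOf_eq_prime hzN.2 hz1'
  have : (Subgroup.zpowers z).Normal := by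
    constructor
    intro x hx g
    have hxc : x ∈ Subgroup.center G := (Subgroup.zpowers_le.2 hzc') hx
    rw [Subgroup.mem_center_iff.1 hxc g]; simpa using hx
  have hNz : N ≤ Subgroup.zpowers z := by
    by_contra hcon
    obtain ⟨y, hyN, hyz, hy⟩ := rel_central hG (Subgroup.zpowers z) N hcon
    exact hP ⟨z, y, hzc', hzo, hyN.2, hyz, hy⟩
  let : CommGroup A := { (inferInstance : Group A) with
    mul_comm := fun x y => Subtype.ext (hAc x x.2 y y.2) }
  have hcyc : IsCyclic A := by
    apply cyclic_of (p := p) (hG.to_subgroup A)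
    have : Nat.card (Subgroup.zpowers z) = p := by rw [Nat.card_zpowers, hzo]
    refine le_trans ?_ this.le
    let g : (powMonoidHom p : A →* A).ker → Subgroup.zpowers z := fun x => ⟨x.1.1, hNz ⟨x.1.2, by
      have := x.2
      rw [MonoidHom.mem_ker] at this
      exact congrArg Subtype.val this⟩⟩
    apply Nat.card_le_card_of_injective g
    intro x y hxy
    exact Subtype.ext (Subtype.ext (congrArg (fun t : Subgroup.zpowers z => (t : G)) hxy))
  obtain ⟨⟨a, haA⟩, ha⟩ := hcyc
  have haz : A = Subgroup.zpowers a := by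
    apply le_antisymm
    · intro x hx
      obtain ⟨i, hi⟩ := Subgroup.mem_zpowers_iff.1 (ha ⟨x, hx⟩)
      exact Subgroup.mem_zpowers_iff.2 ⟨i, congrArg Subtype.val hi⟩
    · exact Subgroup.zpowers_le.2 haA
  obtain ⟨n, hn⟩ := (IsPGroup.iff_orderOf.1 hG) a
  have hn1 : 1 ≤ n := by
    rw [Nat.one_le_iff_ne_zero]
    rintro rfl
    rw [pow_zero, orderOf_eq_one_iff] at hn
    apply hAb
    rw [haz, hn]; simp
  refine ⟨a, n, hn1, hn, ?_, ?_, ?_⟩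
  · intro g; rw [← haz]; exact hAn.conj_mem a haA g
  · intro g hg
    rw [← haz]
    apply hAC
    intro x hx
    rw [haz] at hx
    obtain ⟨i, rfl⟩ := Subgroup.mem_zpowers_iff.1 hx
    exact (show Commute g a from hg).zpow_right i
  · apply (Subgroup.zpowers_le.2 hzc')
    apply hNz
    refine ⟨A.pow_mem haA _, ?_⟩
    rw [← pow_mul, ← pow_succ, Nat.sub_add_cancel hn1, ← hn, pow_orderOf_eq_one]
lemma twist_pow {G : Type} [Group G] (b x w : G) (hw : ∀ g, w * g = g * w) (h : x * b = w * (b * x))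
    (m : ℕ) : (b * x) ^ m = b ^ m * x ^ m * w ^ (m.choose 2) := by
  have h1 : ∀ m : ℕ, x ^ m * b = b * x ^ m * w ^ m := by
    intro m
    induction m with
    | zero => simp
    | succ m ih =>
      have hwm : Commute (w ^ m) x := (show Commute w x from hw x).pow_left m
      calc x ^ (m+1) * b = x ^ m * (x * b) := by rw [pow_succ, mul_assoc]
        _ = (x ^ m * b) * x * w := by rw [h, hw]; simp only [mul_assoc]
        _ = b * x ^ m * (w ^ m * x) * w := by rw [ih]; simp only [mul_assoc]
        _ = b * x ^ (m+1) * w ^ (m+1) := by rw [hwm.eq, pow_succ x, pow_succ w]; simp only [mul_assoc]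
  induction m with
  | zero => simp
  | succ m ih =>
    have hwm : Commute (w ^ (m.choose 2)) (b * x) := (show Commute w (b * x) from hw _).pow_left _
    have hwm' : Commute (w ^ m) x := (show Commute w x from hw x).pow_left m
    calc (b * x) ^ (m+1) = b ^ m * x ^ m * (w ^ (m.choose 2) * (b * x)) := by
          rw [pow_succ, ih]; simp only [mul_assoc]
      _ = b ^ m * (x ^ m * b) * x * w ^ (m.choose 2) := by rw [hwm.eq]; simp only [mul_assoc]
      _ = b ^ m * b * x ^ m * (w ^ m * x) * w ^ (m.choose 2) := by rw [h1]; simp only [mul_assoc]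
      _ = b ^ (m+1) * x ^ (m+1) * w ^ ((m+1).choose 2) := by
          rw [hwm'.eq, pow_succ b, pow_succ x, Nat.choose_succ_succ' m 1, pow_add, Nat.choose_one_right]
          simp only [mul_assoc]

lemma conj_zpow_of {G : Type} [Group G] {a g : G} {u : ℤ} (h : g * a * g⁻¹ = a ^ u) (i : ℤ) :
    g * a ^ i * g⁻¹ = a ^ (u * i) := by
  rw [← conj_zpow, h, ← zpow_mul]

lemma conj_mul_of {G : Type} [Group G] {a g h : G} {u v : ℤ} (hg : g * a * g⁻¹ = a ^ u)
    (hh : h * a * h⁻¹ = a ^ v) : (g * h) * a * (g * h)⁻¹ = a ^ (u * v) := by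
  rw [← conj_zpow_of hg, ← hh]; group

lemma step_ii {p : ℕ} [Fact p.Prime] {G : Type} [Group G] (hP : ¬ HasPair p G)
    {a : G} {n : ℕ} (hn : 1 ≤ n) (ha : orderOf a = p ^ n)
    (hconj : ∀ g, g * a * g⁻¹ ∈ Subgroup.zpowers a)
    (hcent : ∀ g, g * a = a * g → g ∈ Subgroup.zpowers a)
    (hz : a ^ p ^ (n-1) ∈ Subgroup.center G)
    {x : G} (hx : x ∉ Subgroup.zpowers a) (hxp : x ^ p ∈ Subgroup.zpowers a) {u : ℤ}
    (hu : x * a * x⁻¹ = a ^ u) (hu1 : (p : ℤ) ^ (n-1) ∣ u - 1) (h2 : p = 2 → 3 ≤ n) : False := by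
  have hp : p.Prime := Fact.out
  have hpn : (p : ℤ) ^ n = p ^ (n-1) * p := by rw [← pow_succ, Nat.sub_add_cancel hn]
  have hp0 : (p : ℤ) ^ (n-1) ≠ 0 := pow_ne_zero _ (by exact_mod_cast hp.ne_zero)
  have hpz : Prime (p : ℤ) := Nat.prime_iff_prime_int.1 hp
  have hord : ∀ i : ℤ, a ^ i = 1 ↔ (p : ℤ) ^ n ∣ i := by
    intro i
    rw [← orderOf_dvd_iff_zpow_eq_one, ha]; push_cast; rfl
  set z := a ^ p ^ (n-1) with hzdef
  have hza : ∀ i : ℤ, z ^ i = a ^ ((p : ℤ) ^ (n-1) * i) := by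
    intro i; rw [hzdef, zpow_mul]; congr 1
    rw [← Nat.cast_pow, zpow_natCast]
  have hzc : ∀ g, z * g = g * z := fun g => (Subgroup.mem_center_iff.1 hz g).symm
  have hzic : ∀ (i : ℤ) g, z ^ i * g = g * z ^ i := fun i g => (show Commute z g from hzc g).zpow_left i
  have hzo : orderOf z = p := by
    rw [hzdef, orderOf_pow_of_dvd (pow_ne_zero _ hp.ne_zero), ha]
    · exact Nat.div_eq_of_eq_mul_left (pow_pos hp.pos _) (by rw [← pow_succ', Nat.sub_add_cancel hn])
    · rw [ha]; exact pow_dvd_pow _ (Nat.sub_le _ _)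
  have hzp : ∀ i : ℤ, z ^ i = 1 ↔ (p : ℤ) ∣ i := by
    intro i
    rw [← orderOf_dvd_iff_zpow_eq_one, hzo]
  obtain ⟨j, hj⟩ := hu1
  have hxz : ∀ r : ℤ, x * a ^ r = z ^ (j * r) * (a ^ r * x) := by
    intro r
    have := conj_zpow_of hu r
    rw [mul_inv_eq_iff_eq_mul] at this
    rw [this, hza, ← mul_assoc, ← zpow_add]
    congr 2
    have : u = 1 + p ^ (n-1) * j := by linarith
    rw [this]; ring
  have hpj : ¬ (p : ℤ) ∣ j := by
    intro hd
    apply hx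
    apply hcent
    have := hxz 1
    rw [mul_one, (hzp j).2 hd] at this
    simpa using this
  obtain ⟨t, ht⟩ := Subgroup.mem_zpowers_iff.1 hxp
  have hpt : (p : ℤ) ∣ t := by
    have h1 := hxz t
    rw [ht, ← pow_succ, ← pow_succ', right_eq_mul, hzp] at h1
    exact (hpz.dvd_or_dvd h1).resolve_left hpj
  obtain ⟨s, hs⟩ := hpt
  have hpow : ∀ r : ℤ, (a ^ r * x) ^ p = a ^ (p * (r + s)) * z ^ (j * r * (p.choose 2 : ℕ)) := by
    intro r
    rw [twist_pow (a ^ r) x (z ^ (j * r)) (hzic _) (hxz r), ← ht, ← zpow_natCast (a ^ r), ← zpow_mul,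
      ← zpow_add, ← zpow_natCast (z ^ (j * r)), ← zpow_mul]
    congr 2
    rw [hs]; ring
  have hch : p ≠ 2 → (p : ℤ) ∣ (p.choose 2 : ℕ) := by
    intro h
    exact_mod_cast hp.dvd_choose_self two_ne_zero (lt_of_le_of_ne hp.two_le (Ne.symm h))
  obtain ⟨r, hr⟩ : ∃ r : ℤ, (a ^ r * x) ^ p = 1 := by
    by_cases hp2 : p = 2
    · have hn3 := h2 hp2
      obtain ⟨m, rfl⟩ : ∃ m, n = m + 3 := ⟨n - 3, by omega⟩
      rcases Int.even_or_odd' s with ⟨s', hs' | hs'⟩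
      · refine ⟨-s, ?_⟩
        rw [hpow, (hzp _).2]
        · simp
        · subst hp2; rw [hs']; exact ⟨-j * s', by simp; ring⟩
      · refine ⟨-s + 2 ^ (m+1), ?_⟩
        rw [hpow]
        have : a ^ ((p : ℤ) * (-s + 2 ^ (m+1) + s)) = z ^ (1 : ℤ) := by
          rw [hza]; congr 1; subst hp2; simp; ring
        rw [this, ← zpow_add, hzp]
        have hjo : j % 2 = 1 := by
          subst hp2; push_cast at hpj; omega
        obtain ⟨j', hj'⟩ : ∃ j', j = 2 * j' + 1 := ⟨j / 2, by omega⟩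
        subst hp2
        rw [hs', hj']
        refine ⟨- 2 * j' * s' - s' - j' + (2 * j' + 1) * 2 ^ m, ?_⟩
        simp; ring
    · refine ⟨-s, ?_⟩
      rw [hpow, (hzp _).2]
      · simp
      · exact Dvd.dvd.mul_left (hch hp2) _
  set y := a ^ r * x with hy
  have hyA : y ∉ Subgroup.zpowers a := by
    intro h
    apply hx
    have := (Subgroup.zpowers a).mul_mem ((Subgroup.zpowers a).zpow_mem (Subgroup.mem_zpowers a) (-r)) h
    simpa [hy] using this
  have hyz : ∀ i : ℤ, y * a ^ i = z ^ (j * i) * (a ^ i * y) := by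
    intro i
    calc y * a ^ i = a ^ r * (x * a ^ i) := by rw [hy, mul_assoc]
      _ = z ^ (j * i) * (a ^ r * a ^ i * x) := by rw [hxz, ← mul_assoc, ← hzic]; simp only [mul_assoc]
      _ = z ^ (j * i) * (a ^ i * y) := by rw [← zpow_add, add_comm, zpow_add, hy]; simp only [mul_assoc]
  apply hP
  refine ⟨z, y, hz, hzo, hr, ?_, ?_⟩
  · intro h
    exact hyA ((Subgroup.zpowers_le.2 ((Subgroup.zpowers a).pow_mem (Subgroup.mem_zpowers a) _)) h)
  intro g
  obtain ⟨ug, hug⟩ := Subgroup.mem_zpowers_iff.1 (hconj g)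
  obtain ⟨uy, huy⟩ := Subgroup.mem_zpowers_iff.1 (hconj y)
  have hmem : g * y * g⁻¹ * y⁻¹ ∈ Subgroup.zpowers a := by
    apply hcent
    have h1 := conj_mul_of hug.symm huy.symm
    have h2 := conj_mul_of huy.symm hug.symm
    rw [mul_comm uy ug, ← h1] at h2
    have h3 : (g * y) * a * (g * y)⁻¹ = (y * g) * a * (y * g)⁻¹ := h2.symm
    -- replace a by conj
    have h4 : (y * g)⁻¹ * (g * y) * a = a * ((y * g)⁻¹ * (g * y)) := by
      have := congrArg (fun t => (y * g)⁻¹ * t * (g * y)) h3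
      simpa [mul_assoc] using this
    have h5 := hcent _ h4
    obtain ⟨i, hi⟩ := Subgroup.mem_zpowers_iff.1 h5
    have h6 : g * y * g⁻¹ * y⁻¹ = (y * g) * a ^ i * (y * g)⁻¹ := by
      rw [hi]; group
    rw [h6, conj_zpow_of (conj_mul_of huy.symm hug.symm)]
    exact (Commute.zpow_self a _).eq
  obtain ⟨i, hi⟩ := Subgroup.mem_zpowers_iff.1 hmem
  have h1 : (a ^ i * y) ^ p = 1 := by
    rw [hi]
    have : g * y * g⁻¹ * y⁻¹ * y = g * y * g⁻¹ := by group
    rw [this, conj_pow, hr]; simp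
  rw [twist_pow (a ^ i) y (z ^ (j * i)) (hzic _) (hyz i), hr, mul_one, ← zpow_natCast (a ^ i), ← zpow_mul,
    ← zpow_natCast (z ^ (j * i)), ← zpow_mul] at h1
  have h3 : (p : ℤ) ^ (n-1) ∣ i := by
    by_cases hp2 : p = 2
    · have hn3 := h2 hp2
      obtain ⟨m, rfl⟩ : ∃ m, n = m + 3 := ⟨n - 3, by omega⟩
      subst hp2
      rw [hza, ← zpow_add, hord] at h1
      simp only [Nat.choose_self, Nat.cast_ofNat, Nat.cast_one, mul_one,
        show m + 3 - 1 = m + 2 by omega] at h1 ⊢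
      have h4 : i * 2 + 2 ^ (m+2) * (j * i) = 2 * ((1 + 2 * (2 ^ m * j)) * i) := by ring
      rw [h4, show (2:ℤ) ^ (m+3) = 2 * 2 ^ (m+2) by ring] at h1
      have h5 := Int.dvd_of_mul_dvd_mul_left (by norm_num) h1
      refine IsCoprime.dvd_of_dvd_mul_left ?_ h5
      apply IsCoprime.pow_left
      exact ⟨-(2 ^ m * j), 1, by ring⟩
    · rw [(hzp _).2 (Dvd.dvd.mul_left (hch hp2) _), mul_one, hord, hpn] at h1
      exact Int.dvd_of_mul_dvd_mul_right (by exact_mod_cast hp.ne_zero) h1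
  obtain ⟨i', rfl⟩ := h3
  rw [← hi, ← hza]
  exact Subgroup.mem_zpowers_iff.2 ⟨i', rfl⟩

lemma lte_aux {p : ℕ} (hp : p.Prime) (hp2 : p ≠ 2) {n : ℕ} (hn : 1 ≤ n) {u : ℤ}
    (h : (p : ℤ) ^ n ∣ u ^ p - 1) : (p : ℤ) ^ (n-1) ∣ u - 1 := by
  have := Fact.mk hp
  have h1 : (p : ℤ) ∣ u - 1 := by
    have h0 : (p : ℤ) ∣ u ^ p - 1 := (dvd_pow_self _ (by omega)).trans h
    rw [← ZMod.intCast_zmod_eq_zero_iff_dvd] at h0 ⊢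
    push_cast at h0 ⊢
    rwa [ZMod.pow_card] at h0
  have h2 : ¬ (p : ℤ) ∣ u := by
    intro h2
    have := dvd_sub h2 h1
    have h3 : (p : ℤ) ∣ 1 := by simpa using this
    exact hp.one_lt.ne' (by exact_mod_cast Int.eq_one_of_dvd_one (by positivity) h3)
  have h3 := Int.emultiplicity_pow_sub_pow hp (hp.odd_of_ne_two hp2) h1 h2 p
  rw [one_pow] at h3
  rw [pow_dvd_iff_le_emultiplicity] at h ⊢
  rw [h3, (Nat.finiteMultiplicity_iff.2 ⟨hp.one_lt.ne', hp.pos⟩).emultiplicity_self] at h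
  obtain ⟨m, rfl⟩ : ∃ m, n = m + 1 := ⟨n - 1, by omega⟩
  push_cast at h
  simpa using (ENat.add_le_add_iff_right (by simp)).1 h

lemma roq_struct {p : ℕ} [Fact p.Prime] {G : Type} [Group G] [Finite G] (hG : IsPGroup p G)
    (hP : ¬ HasPair p G) (hnc : ¬ ∀ x y : G, x * y = y * x) :
    p = 2 ∧ ∃ (a z c : G), (Subgroup.zpowers a).index = 2 ∧
      z ∈ Subgroup.center G ∧ z ≠ 1 ∧ z * z = 1 ∧ c ∈ Subgroup.zpowers a ∧ c * c = z ∧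
      ∀ x ∉ Subgroup.zpowers a, x * x = 1 ∨ x * x = z := by
  have hp : p.Prime := Fact.out
  obtain ⟨a, n, hn, ha, hconj, hcent, hz⟩ := cyc_struct hG hP hnc
  have hord : ∀ i : ℤ, a ^ i = 1 ↔ (p : ℤ) ^ n ∣ i := by
    intro i
    rw [← orderOf_dvd_iff_zpow_eq_one, ha]; push_cast; rfl
  have hord2 : ∀ i j : ℤ, a ^ i = a ^ j ↔ (p : ℤ) ^ n ∣ i - j := by
    intro i j
    rw [← hord, zpow_sub, mul_inv_eq_one]
  have hcA : ∀ x ∈ Subgroup.zpowers a, ∀ y ∈ Subgroup.zpowers a, x * y = y * x := by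
    intro x hx y hy
    obtain ⟨i, rfl⟩ := Subgroup.mem_zpowers_iff.1 hx
    obtain ⟨j, rfl⟩ := Subgroup.mem_zpowers_iff.1 hy
    exact (Commute.zpow_zpow_self a i j).eq
  have hex : ∃ g, g ∉ Subgroup.zpowers a := by
    by_contra! hcon
    exact hnc fun x y => hcA x (hcon x) y (hcon y)
  have hch : ∀ g, ∃ u : ℤ, g * a * g⁻¹ = a ^ u := fun g => by
    obtain ⟨u, hu⟩ := Subgroup.mem_zpowers_iff.1 (hconj g)
    exact ⟨u, hu.symm⟩
  choose u hu using hch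
  have humul : ∀ g h, a ^ (u (g * h)) = a ^ (u g * u h) := fun g h => by
    rw [← hu, conj_mul_of (hu g) (hu h)]
  have huA : ∀ g ∈ Subgroup.zpowers a, (p : ℤ) ^ n ∣ u g - 1 := by
    intro g hg
    rw [← hord2, ← hu, hcA g hg a (Subgroup.mem_zpowers a)]; simp
  have huA' : ∀ g, (p : ℤ) ^ n ∣ u g - 1 → g ∈ Subgroup.zpowers a := by
    intro g hg
    rw [← hord2, ← hu, zpow_one, mul_inv_eq_iff_eq_mul] at hg
    exact hcent g hg
  have hupow : ∀ g (m : ℕ), a ^ (u (g ^ m)) = a ^ (u g ^ m) := by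
    intro g m
    rw [← hu]
    induction m with
    | zero => simp
    | succ m ih => rw [pow_succ, conj_mul_of ih (hu g), pow_succ]
  have hdesc : ∀ g, g ∉ Subgroup.zpowers a → ∃ j : ℕ, g ^ p ^ j ∉ Subgroup.zpowers a ∧
      g ^ p ^ (j+1) ∈ Subgroup.zpowers a := by
    intro g hg
    have hE : ∃ j : ℕ, g ^ p ^ j ∈ Subgroup.zpowers a := by
      obtain ⟨k, hk⟩ := hG g
      exact ⟨k, by rw [hk]; exact Subgroup.one_mem _⟩
    classical
    have h0 : Nat.find hE ≠ 0 := by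
      intro h0
      have := Nat.find_spec hE
      rw [h0] at this
      exact hg (by simpa using this)
    obtain ⟨j, hj⟩ := Nat.exists_eq_succ_of_ne_zero h0
    refine ⟨j, Nat.find_min hE (by omega), ?_⟩
    have := Nat.find_spec hE
    rwa [hj] at this
  have hp2 : p = 2 := by
    by_contra hp2
    obtain ⟨g, hg⟩ := hex
    obtain ⟨j, hj1, hj2⟩ := hdesc g hg
    set x := g ^ p ^ j
    have hxp : x ^ p ∈ Subgroup.zpowers a := by
      rw [← pow_mul, ← pow_succ]; exact hj2
    have h1 := huA _ hxp
    rw [← hord2, hupow, hord2] at h1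
    exact step_ii hP hn ha hconj hcent hz hj1 hxp (hu x) (lte_aux hp hp2 hn h1) (fun h => absurd h hp2)
  subst hp2
  push_cast at hord hord2 huA huA'
  have hodd : ∀ x, u x % 2 = 1 := by
    intro x
    have h1 : a ^ (u x * u x⁻¹) = a ^ (1 : ℤ) := by rw [← humul, mul_inv_cancel, ← hu]; simp
    rw [hord2] at h1
    have h2 : (2 : ℤ) ∣ u x * u x⁻¹ - 1 := (dvd_pow_self _ (by omega)).trans h1
    by_contra h3
    have h4 : (2 : ℤ) ∣ u x * u x⁻¹ := Dvd.dvd.mul_right (by omega) _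
    omega
  have hn2 : 2 ≤ n := by
    by_contra hcon
    obtain ⟨g, hg⟩ := hex
    apply hg
    apply huA'
    have : n = 1 := by omega
    subst this
    have := hodd g
    rw [pow_one]; omega
  have h4 : ∀ i j : ℤ, a ^ i = a ^ j → i % 4 = j % 4 := by
    intro i j hij
    rw [hord2] at hij
    have : (4 : ℤ) ∣ i - j := (by rw [show (4:ℤ) = 2 ^ 2 by norm_num]; exact (pow_dvd_pow 2 hn2).trans hij)
    omega
  have hu3 : ∀ x, x ∉ Subgroup.zpowers a → x ^ 2 ∈ Subgroup.zpowers a → u x % 4 = 3 := by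
    intro x hx hx2
    by_contra h3
    have h1 : u x % 4 = 1 := by have := hodd x; omega
    by_cases hn3 : 3 ≤ n
    · refine step_ii hP hn ha hconj hcent hz hx hx2 (hu x) ?_ (fun _ => hn3)
      have h5 := huA _ hx2
      rw [← hord2, hupow, hord2] at h5
      obtain ⟨m, rfl⟩ : ∃ m, n = m + 1 := ⟨n - 1, by omega⟩
      obtain ⟨v, hv⟩ : ∃ v, u x = 4 * v + 1 := ⟨u x / 4, by omega⟩
      rw [hv] at h5 ⊢
      rw [show (4 * v + 1) ^ 2 - 1 = 2 * ((2 * v + 1) * (4 * v + 1 - 1)) by ring, pow_succ'] at h5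
      have h6 := Int.dvd_of_mul_dvd_mul_left (by norm_num) h5
      refine IsCoprime.dvd_of_dvd_mul_left ?_ h6
      apply IsCoprime.pow_left
      exact ⟨-v, 1, by ring⟩
    · apply hx
      apply huA'
      have : n = 2 := by omega
      subst this
      norm_num; omega
  have hsq : ∀ x, x ^ 2 ∈ Subgroup.zpowers a := by
    intro x
    by_contra hx
    obtain ⟨j, hj1, hj2⟩ := hdesc _ hx
    rw [← pow_mul, mul_comm, pow_mul] at hj1 hj2
    have h5 := hu3 _ hj1 (by rw [pow_succ 2 j, pow_mul] at hj2; exact hj2)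
    have h6 := h4 _ _ (hupow (x ^ 2 ^ j) 2)
    have h7 := hodd (x ^ 2 ^ j)
    rw [h5, pow_two, Int.mul_emod] at h6
    have : u (x ^ 2 ^ j) % 4 = 1 ∨ u (x ^ 2 ^ j) % 4 = 3 := by omega
    rcases this with h | h <;> rw [h] at h6 <;> norm_num at h6
  have hidx : (Subgroup.zpowers a).index = 2 := by
    rw [Subgroup.index_eq_two_iff]
    obtain ⟨x, hx⟩ := hex
    refine ⟨x, fun b => ?_⟩
    by_cases hb : b ∈ Subgroup.zpowers a
    · right
      refine ⟨hb, fun h => hx ?_⟩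
      simpa using (Subgroup.zpowers a).mul_mem ((Subgroup.zpowers a).inv_mem hb) h
    · left
      refine ⟨?_, hb⟩
      by_contra hbx
      have h1 := hu3 _ hx (hsq _)
      have h2 := hu3 _ hb (hsq _)
      have h3 := hu3 _ hbx (hsq _)
      have h5 := h4 _ _ (humul b x)
      rw [Int.mul_emod, h1, h2, h3] at h5
      norm_num at h5
  obtain ⟨m, rfl⟩ : ∃ m, n = m + 2 := ⟨n - 2, by omega⟩
  have hzz : a ^ 2 ^ (m + 2 - 1) * a ^ 2 ^ (m + 2 - 1) = 1 := by
    rw [← pow_add, show 2 ^ (m + 2 - 1) + 2 ^ (m + 2 - 1) = 2 ^ (m+2) by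
      rw [show m + 2 - 1 = m + 1 by omega]; ring, ← ha, pow_orderOf_eq_one]
  refine ⟨rfl, a, a ^ 2 ^ (m + 2 - 1), a ^ 2 ^ m, hidx, hz, ?_, hzz,
    (Subgroup.zpowers a).pow_mem (Subgroup.mem_zpowers a) _, ?_, ?_⟩
  · intro h
    have := Nat.le_of_dvd (by positivity) (orderOf_dvd_of_pow_eq_one h)
    rw [ha] at this
    exact absurd this (not_le.2 (Nat.pow_lt_pow_right (by norm_num) (by omega)))
  · rw [← pow_add]; congr 1; rw [show m + 2 - 1 = m + 1 by omega]; ring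
  · intro x hx
    have h1 := hu3 _ hx (hsq x)
    obtain ⟨t, ht⟩ := Subgroup.mem_zpowers_iff.1 (hsq x)
    have h2 := conj_zpow_of (hu x) t
    rw [ht, show x * x ^ 2 * x⁻¹ = x ^ 2 by group, ← ht, eq_comm, hord2] at h2
    obtain ⟨v, hv⟩ : ∃ v, u x = 4 * v + 3 := ⟨u x / 4, by omega⟩
    rw [hv, show (4 * v + 3) * t - t = 2 * ((2 * v + 1) * t) by ring, pow_succ'] at h2
    have h3 := Int.dvd_of_mul_dvd_mul_left (by norm_num) h2
    have h5 : (2 : ℤ) ^ (m+1) ∣ t := by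
      refine IsCoprime.dvd_of_dvd_mul_left ?_ h3
      apply IsCoprime.pow_left
      exact ⟨-v, 1, by ring⟩
    obtain ⟨s, rfl⟩ := h5
    rw [← pow_two, ← ht, zpow_mul]
    have h6 : a ^ ((2:ℤ) ^ (m+1)) = a ^ 2 ^ (m + 2 - 1) := by
      rw [← zpow_natCast]; congr 1
    rw [h6]
    rcases Int.even_or_odd' s with ⟨s', hs' | hs'⟩
    · left; rw [hs', zpow_mul, zpow_two, hzz, one_zpow]
    · right; rw [hs', zpow_add, zpow_mul, zpow_two, hzz, one_zpow, zpow_one, one_mul]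
def Irr' {Ω G V : Type} [Field Ω] [Group G] [AddCommGroup V] [Module Ω V]
    (ρ : Representation Ω G V) : Prop :=
  Nontrivial V ∧ ∀ U : Submodule Ω V, (∀ g : G, ∀ x ∈ U, ρ g x ∈ U) → U = ⊥ ∨ U = ⊤

def stab {Ω G V : Type} [Field Ω] [Group G] [AddCommGroup V] [Module Ω V]
    (ρ : Representation Ω G V) (v : V) : Subgroup G where
  carrier := {g | ρ g v = v}
  one_mem' := by simp
  mul_mem' := by
    intro a b ha hb
    simp only [Set.mem_setOf_eq] at ha hb ⊢
    rw [map_mul, Module.End.mul_apply, hb, ha]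
  inv_mem' := by
    intro a ha
    simp only [Set.mem_setOf_eq] at ha ⊢
    conv_lhs => rw [← ha]
    rw [← Module.End.mul_apply, ← map_mul]; simp

def fixK {Ω G V : Type} [Field Ω] [Group G] [AddCommGroup V] [Module Ω V]
    (ρ : Representation Ω G V) (K : Subgroup G) : Submodule Ω V where
  carrier := {v | K ≤ stab ρ v}
  zero_mem' := fun g _ => map_zero (ρ g)
  add_mem' := by
    intro a b ha hb g hg
    change ρ g (a + b) = a + b
    rw [map_add, show ρ g a = a from ha hg, show ρ g b = b from hb hg]
  smul_mem' := by
    intro c a ha g hg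
    change ρ g (c • a) = c • a
    rw [map_smul, show ρ g a = a from ha hg]

lemma mem_fixK {Ω G V : Type} [Field Ω] [Group G] [AddCommGroup V] [Module Ω V]
    {ρ : Representation Ω G V} {K : Subgroup G} {v : V} : v ∈ fixK ρ K ↔ K ≤ stab ρ v := Iff.rfl

lemma mem_stab {Ω G V : Type} [Field Ω] [Group G] [AddCommGroup V] [Module Ω V]
    {ρ : Representation Ω G V} {g : G} {v : V} : g ∈ stab ρ v ↔ ρ g v = v := Iff.rfl

lemma schur_scalar {Ω G V : Type} [Field Ω] [IsAlgClosed Ω] [Group G] [AddCommGroup V] [Module Ω V]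
    [FiniteDimensional Ω V] {ρ : Representation Ω G V} (h : Irr' ρ) (T : V →ₗ[Ω] V)
    (hT : ∀ g v, T (ρ g v) = ρ g (T v)) : ∃ c : Ω, ∀ v, T v = c • v := by
  haveI := h.1
  obtain ⟨c, hc⟩ := Module.End.exists_eigenvalue T
  refine ⟨c, ?_⟩
  have := h.2 (Module.End.eigenspace T c) (by
    intro g x hx
    rw [Module.End.mem_eigenspace_iff] at hx ⊢
    rw [hT, hx, map_smul])
  rcases this with h1 | h1
  · exact absurd h1 hc
  · intro v
    have : v ∈ Module.End.eigenspace T c := by rw [h1]; trivial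
    exact Module.End.mem_eigenspace_iff.1 this

lemma central_scalar {Ω G V : Type} [Field Ω] [IsAlgClosed Ω] [Group G] [AddCommGroup V] [Module Ω V]
    [FiniteDimensional Ω V] {ρ : Representation Ω G V} (h : Irr' ρ) {z : G} (hz : ∀ g, z * g = g * z) :
    ∃ c : Ω, ∀ v, ρ z v = c • v := by
  apply schur_scalar h
  intro g v
  rw [← Module.End.mul_apply, ← Module.End.mul_apply, ← map_mul, ← map_mul, hz]

/-- goal statement for one representation -/
def Good {Ω G V : Type} [Field Ω] [Group G] [Fintype G] [AddCommGroup V] [Module Ω V]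
    (p : ℕ) (ρ : Representation Ω G V) : Prop :=
  ∃ K : Subgroup G, Module.finrank Ω (fixK ρ K) = 1 ∨
    (Module.finrank Ω (fixK ρ K) = 2 ∧ p = 2 ∧
      ∑ g : G, LinearMap.trace Ω V (ρ (g * g)) = -(Fintype.card G : Ω))

lemma fixK_bot {Ω G V : Type} [Field Ω] [Group G] [AddCommGroup V] [Module Ω V]
    (ρ : Representation Ω G V) : fixK ρ ⊥ = ⊤ := by
  rw [eq_top_iff]; intro v _; rw [mem_fixK]; exact bot_le

lemma good_abelian {Ω G V : Type} [Field Ω] [IsAlgClosed Ω] [Group G] [Fintype G] [AddCommGroup V]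
    [Module Ω V] [FiniteDimensional Ω V] (p : ℕ) {ρ : Representation Ω G V} (h : Irr' ρ)
    (hc : ∀ x y : G, x * y = y * x) : Good p ρ := by
  refine ⟨⊥, Or.inl ?_⟩
  rw [fixK_bot, finrank_top]
  haveI := h.1
  obtain ⟨v, hv⟩ := exists_ne (0 : V)
  rw [finrank_eq_one_iff_of_nonzero v hv]
  refine (h.2 (Submodule.span Ω {v}) ?_).resolve_left ?_
  · intro g x hx
    obtain ⟨c, hc⟩ := central_scalar h (hc g)
    rw [hc]; exact Submodule.smul_mem _ _ hx
  · rw [Submodule.span_singleton_eq_bot]; exact hv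

lemma neg_one_of {Ω G V : Type} [Field Ω] [IsAlgClosed Ω] [Group G] [AddCommGroup V]
    [Module Ω V] [FiniteDimensional Ω V] {ρ : Representation Ω G V} (h : Irr' ρ)
    (hf : Function.Injective ρ) {z : G} (hz : z ∈ Subgroup.center G) (hz1 : z ≠ 1) (hzz : z * z = 1) :
    ∀ v, ρ z v = - v := by
  obtain ⟨c, hc⟩ := central_scalar h (fun g => (Subgroup.mem_center_iff.1 hz g).symm)
  haveI := h.1
  obtain ⟨v, hv⟩ := exists_ne (0 : V)
  have h1 : (c * c) • v = (1 : Ω) • v := by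
    rw [mul_smul, ← hc, ← hc, ← Module.End.mul_apply, ← map_mul, hzz]; simp
  have h2 := smul_left_injective Ω hv h1
  rcases mul_self_eq_one_iff.1 h2 with h3 | h3
  · exfalso
    apply hz1
    apply hf
    ext w
    rw [hc, h3]; simp
  · intro w; rw [hc, h3, neg_one_smul]

lemma good_roq {Ω G V : Type} [Field Ω] [IsAlgClosed Ω] [CharZero Ω] [Group G] [Fintype G]
    [AddCommGroup V] [Module Ω V] [FiniteDimensional Ω V] {ρ : Representation Ω G V} (h : Irr' ρ)
    (hf : Function.Injective ρ) (hnc : ¬ ∀ x y : G, x * y = y * x) {a z c : G}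
    (hA : (Subgroup.zpowers a).index = 2) (hz : z ∈ Subgroup.center G) (hz1 : z ≠ 1) (hzz : z * z = 1)
    (hcA : c ∈ Subgroup.zpowers a) (hcc : c * c = z)
    (hx : ∀ x ∉ Subgroup.zpowers a, x * x = 1 ∨ x * x = z) : Good 2 ρ := by
  have hzn := neg_one_of h hf hz hz1 hzz
  have hmul : ∀ {x y : G}, x * y ∈ Subgroup.zpowers a ↔ (x ∈ Subgroup.zpowers a ↔ y ∈ Subgroup.zpowers a) :=
    Subgroup.mul_mem_iff_of_index_two hA
  haveI := h.1
  have hdim : Module.finrank Ω V = 2 := by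
    obtain ⟨μ, hμ⟩ := Module.End.exists_eigenvalue (ρ a)
    obtain ⟨v, hv⟩ := hμ.exists_hasEigenvector
    obtain ⟨x, hxA⟩ : ∃ x, x ∉ Subgroup.zpowers a := by
      by_contra! hcon
      have : Subgroup.zpowers a = ⊤ := by rw [eq_top_iff]; intro g _; exact hcon g
      rw [this] at hA; simp at hA
    have hAv : ∀ g ∈ Subgroup.zpowers a, ∃ c : Ω, ρ g v = c • v := by
      intro g hg
      rw [← mem_powers_iff_mem_zpowers] at hg
      obtain ⟨m, rfl⟩ := hg
      refine ⟨μ ^ m, ?_⟩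
      rw [map_pow, hv.pow_apply]
    have hall : ∀ g, ρ g v ∈ Submodule.span Ω {v, ρ x v} := by
      intro g
      by_cases hg : g ∈ Subgroup.zpowers a
      · obtain ⟨c, hc⟩ := hAv g hg
        rw [hc]; exact Submodule.smul_mem _ _ (Submodule.subset_span (by simp))
      · have : x⁻¹ * g ∈ Subgroup.zpowers a := by
          rw [hmul, inv_mem_iff]; tauto
        obtain ⟨c, hc⟩ := hAv _ this
        have h2 : ρ g v = c • ρ x v := by
          rw [← map_smul, ← hc, ← Module.End.mul_apply, ← map_mul]; simp
        rw [h2]; exact Submodule.smul_mem _ _ (Submodule.subset_span (by simp))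
    have htop : Submodule.span Ω {v, ρ x v} = ⊤ := by
      refine (h.2 _ ?_).resolve_left ?_
      · intro g w hw
        have : Submodule.span Ω {v, ρ x v} ≤ (Submodule.span Ω {v, ρ x v}).comap (ρ g) := by
          rw [Submodule.span_le]
          rintro w (rfl | rfl)
          · exact hall g
          · change ρ g (ρ x v) ∈ Submodule.span Ω {v, ρ x v}
            rw [← Module.End.mul_apply, ← map_mul]; exact hall _
        exact this hw
      · intro hb
        have : v ∈ Submodule.span Ω {v, ρ x v} := Submodule.subset_span (by simp)
        rw [hb] at this
        exact hv.2 (by simpa using this)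
    have hle : Module.finrank Ω V ≤ 2 := by
      rw [← finrank_top Ω V, ← htop]
      refine (finrank_span_le_card _).trans ?_
      rw [Set.toFinset_insert, Set.toFinset_singleton]
      exact Finset.card_le_two
    have hpos : 0 < Module.finrank Ω V := Module.finrank_pos
    have hne : Module.finrank Ω V ≠ 1 := by
      intro h1
      apply hnc
      intro x y
      apply hf
      obtain ⟨c, hc, -⟩ := LinearMap.existsUnique_eq_smul_id_of_finrank_eq_one h1 (ρ x)
      rw [map_mul, map_mul, hc]
      ext w; simp
    omega
  by_cases hinv : ∃ x, x ∉ Subgroup.zpowers a ∧ x * x = 1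
  · obtain ⟨x, hxA, hxx⟩ := hinv
    refine ⟨Subgroup.zpowers x, Or.inl ?_⟩
    have hmem : ∀ v, v ∈ fixK ρ (Subgroup.zpowers x) ↔ ρ x v = v := by
      intro v; rw [mem_fixK, Subgroup.zpowers_le, mem_stab]
    have h1 : fixK ρ (Subgroup.zpowers x) ≠ ⊤ := by
      intro ht
      apply hxA
      have : x = 1 := by
        apply hf
        ext w
        rw [map_one, Module.End.one_apply]
        exact (hmem w).1 (by rw [ht]; trivial)
      rw [this]; exact Subgroup.one_mem _
    have h2 : fixK ρ (Subgroup.zpowers x) ≠ ⊥ := by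
      intro hb
      apply hxA
      have : x = z := by
        apply hf
        ext w
        rw [hzn]
        have : w + ρ x w ∈ fixK ρ (Subgroup.zpowers x) := by
          rw [hmem, map_add, ← Module.End.mul_apply, ← map_mul, hxx, map_one, Module.End.one_apply, add_comm]
        rw [hb, Submodule.mem_bot] at this
        exact eq_neg_of_add_eq_zero_right this
      rw [this, ← hcc]; exact Subgroup.mul_mem _ hcA hcA
    have h3 := Submodule.finrank_lt h1
    have h4 : Module.finrank Ω (fixK ρ (Subgroup.zpowers x)) ≠ 0 := by
      rwa [Ne, Submodule.finrank_eq_zero]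
    omega
  · push Not at hinv
    refine ⟨⊥, Or.inr ⟨by rw [fixK_bot, finrank_top, hdim], rfl, ?_⟩⟩
    have hx' : ∀ x ∉ Subgroup.zpowers a, x * x = z := fun x hxA => (hx x hxA).resolve_left (hinv x hxA)
    obtain ⟨x, hxA⟩ : ∃ x, x ∉ Subgroup.zpowers a := by
      by_contra! hcon
      have : Subgroup.zpowers a = ⊤ := by rw [eq_top_iff]; intro g _; exact hcon g
      rw [this] at hA; simp at hA
    have hneg : ∀ g, ρ (g * z) = - ρ g := by
      intro g; ext w
      rw [map_mul, Module.End.mul_apply, hzn]; simp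
    have hS1 : ∑ g : G, (if g ∈ Subgroup.zpowers a then LinearMap.trace Ω V (ρ (g * g)) else 0) = 0 := by
      have h1 := Equiv.sum_comp (Equiv.mulRight c)
        (fun g : G => if g ∈ Subgroup.zpowers a then LinearMap.trace Ω V (ρ (g * g)) else 0)
      have h2 : ∀ g : G, (if Equiv.mulRight c g ∈ Subgroup.zpowers a then
          LinearMap.trace Ω V (ρ (Equiv.mulRight c g * Equiv.mulRight c g)) else 0) =
          - (if g ∈ Subgroup.zpowers a then LinearMap.trace Ω V (ρ (g * g)) else 0) := by
        intro g
        simp only [Equiv.coe_mulRight, Subgroup.mul_mem_cancel_right _ hcA]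
        split_ifs with hg
        · have hcg : c * g = g * c := by
            obtain ⟨i, rfl⟩ := Subgroup.mem_zpowers_iff.1 hg
            obtain ⟨j, rfl⟩ := Subgroup.mem_zpowers_iff.1 hcA
            exact (Commute.zpow_zpow_self a j i).eq
          have : g * c * (g * c) = (g * g) * z := by
            rw [← hcc]; calc g * c * (g * c) = g * (c * g) * c := by simp only [mul_assoc]
              _ = _ := by rw [hcg]; simp only [mul_assoc]
          rw [this, hneg, map_neg]
        · simp
      simp only [h2, Finset.sum_neg_distrib] at h1
      exact self_eq_neg.1 h1.symm
    have hcount : ∑ g : G, (if g ∈ Subgroup.zpowers a then (0:Ω) else 2) = Fintype.card G := by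
      have h1 := Equiv.sum_comp (Equiv.mulRight x)
        (fun g : G => if g ∈ Subgroup.zpowers a then (0:Ω) else 2)
      have h2 : ∀ g : G, (if Equiv.mulRight x g ∈ Subgroup.zpowers a then (0:Ω) else 2) =
          2 - (if g ∈ Subgroup.zpowers a then (0:Ω) else 2) := by
        intro g
        simp only [Equiv.coe_mulRight, hmul, hxA, iff_false]
        split_ifs <;> simp
      simp only [h2, Finset.sum_sub_distrib] at h1
      simp only [Finset.sum_const, Finset.card_univ, nsmul_eq_mul] at h1
      linear_combination (-1/2 : Ω) * h1
    have : ∀ g : G, LinearMap.trace Ω V (ρ (g * g)) =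
        (if g ∈ Subgroup.zpowers a then LinearMap.trace Ω V (ρ (g * g)) else 0) -
        (if g ∈ Subgroup.zpowers a then (0:Ω) else 2) := by
      intro g
      split_ifs with hg
      · simp
      · rw [hx' g hg, ← one_mul z, hneg, map_neg, map_one, LinearMap.trace_one, hdim]; simp
    rw [Finset.sum_congr rfl (fun g _ => this g), Finset.sum_sub_distrib, hS1, hcount, zero_sub]
def subRep {Ω G V : Type} [Field Ω] [Group G] [AddCommGroup V] [Module Ω V]
    (ρ : Representation Ω G V) (H : Subgroup G) (W : Submodule Ω V)
    (hW : ∀ h ∈ H, ∀ w ∈ W, ρ h w ∈ W) : Representation Ω H W where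
  toFun h := (ρ h).restrict (hW h h.2)
  map_one' := by ext w; simp
  map_mul' := by intro a b; ext w; simp

lemma subRep_apply {Ω G V : Type} [Field Ω] [Group G] [AddCommGroup V] [Module Ω V]
    (ρ : Representation Ω G V) (H : Subgroup G) (W : Submodule Ω V)
    (hW : ∀ h ∈ H, ∀ w ∈ W, ρ h w ∈ W) (h : H) (w : W) :
    ((subRep ρ H W hW h w : W) : V) = ρ h w := rfl

lemma prim_of {Ω G V : Type} [Field Ω] [IsAlgClosed Ω] [Group G] [AddCommGroup V]
    [Module Ω V] [FiniteDimensional Ω V] {p : ℕ} (hp : p.Prime) {ρ : Representation Ω G V} (h : Irr' ρ)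
    (hf : Function.Injective ρ) {z : G} (hz : z ∈ Subgroup.center G) (hz1 : orderOf z = p) :
    ∃ ζ : Ω, IsPrimitiveRoot ζ p ∧ ∀ v, ρ z v = ζ • v := by
  obtain ⟨c, hc⟩ := central_scalar h (fun g => (Subgroup.mem_center_iff.1 hz g).symm)
  have := h.1
  obtain ⟨v, hv⟩ := exists_ne (0 : V)
  have hpow : ∀ (i : ℕ) (w : V), ρ (z ^ i) w = c ^ i • w := by
    intro i
    induction i with
    | zero => intro w; simp
    | succ n ih => intro w; rw [pow_succ, map_mul, Module.End.mul_apply, hc, map_smul, ih, smul_smul, pow_succ, mul_comm]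
  refine ⟨c, ?_, hc⟩
  have h1 : c ^ p = 1 := by
    apply smul_left_injective Ω hv
    change c ^ p • v = (1:Ω) • v
    rw [← hpow, ← hz1, pow_orderOf_eq_one]; simp
  have h2 : c ≠ 1 := by
    intro h2
    have : z = 1 := by
      apply hf; ext w; rw [hc, h2]; simp
    rw [this, orderOf_one] at hz1
    exact hp.one_lt.ne hz1
  have := Fact.mk hp
  rw [← orderOf_eq_prime h1 h2]
  exact IsPrimitiveRoot.orderOf c

lemma pow_smul_of {Ω G V : Type} [Field Ω] [Group G] [AddCommGroup V]
    [Module Ω V] {ρ : Representation Ω G V} {z : G} {ζ : Ω} (hζ : ∀ v, ρ z v = ζ • v) (i : ℕ) (v : V) :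
    ρ (z ^ i) v = ζ ^ i • v := by
  induction i generalizing v with
  | zero => simp
  | succ n ih => rw [pow_succ, map_mul, Module.End.mul_apply, hζ, map_smul, ih, smul_smul, pow_succ, mul_comm]

/-- normalise the second element of a pair -/
lemma pair_fix {Ω G V : Type} [Field Ω] [IsAlgClosed Ω] [Group G] [Finite G] [AddCommGroup V]
    [Module Ω V] [FiniteDimensional Ω V] {p : ℕ} (hp : p.Prime) {ρ : Representation Ω G V} (h : Irr' ρ)
    {z y : G} (hz : z ∈ Subgroup.center G) (hzo : orderOf z = p) {ζ : Ω} (hζ : IsPrimitiveRoot ζ p)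
    (hzs : ∀ v, ρ z v = ζ • v) (hy : y ^ p = 1) (hyz : y ∉ Subgroup.zpowers z)
    (hcomm : ∀ g, g * y * g⁻¹ * y⁻¹ ∈ Subgroup.zpowers z) :
    ∃ y : G, y ^ p = 1 ∧ y ∉ Subgroup.zpowers z ∧ (∀ g, g * y * g⁻¹ * y⁻¹ ∈ Subgroup.zpowers z) ∧
      ∃ v, v ≠ 0 ∧ ρ y v = v := by
  have := h.1
  have := Fact.mk hp
  obtain ⟨μ, hμ⟩ := Module.End.exists_eigenvalue (ρ y)
  obtain ⟨v, hv⟩ := hμ.exists_hasEigenvector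
  have h1 : μ ^ p = 1 := by
    apply smul_left_injective Ω hv.2
    change μ ^ p • v = (1:Ω) • v
    rw [← hv.pow_apply, ← map_pow, hy]; simp
  obtain ⟨i, -, hi⟩ := hζ.eq_pow_of_pow_eq_one h1
  have hzi : z ^ i ∈ Subgroup.center G := Subgroup.pow_mem _ hz _
  have hcz : ∀ g, g * z ^ i = z ^ i * g := Subgroup.mem_center_iff.1 hzi
  have hzp : z ^ p = 1 := by rw [← hzo, pow_orderOf_eq_one]
  have hci : ∀ g, (z ^ i)⁻¹ * g = g * (z ^ i)⁻¹ := fun g => by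
    rw [inv_mul_eq_iff_eq_mul, ← mul_assoc, ← hcz, mul_inv_cancel_right]
  have hmem : (z ^ i)⁻¹ ∈ Subgroup.zpowers z :=
      Subgroup.inv_mem _ (Subgroup.pow_mem _ (Subgroup.mem_zpowers z) _)
  refine ⟨y * (z ^ i)⁻¹, ?_, ?_, ?_, v, hv.2, ?_⟩
  · have : Commute y (z ^ i)⁻¹ := (hci y).symm
    rw [this.mul_pow, hy, inv_pow, ← pow_mul, mul_comm i p, pow_mul, hzp]; simp
  · rwa [Subgroup.mul_mem_cancel_right _ hmem]
  · intro g
    have : g * (y * (z ^ i)⁻¹) * g⁻¹ * (y * (z ^ i)⁻¹)⁻¹ = g * y * g⁻¹ * y⁻¹ := by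
      rw [mul_inv_rev, inv_inv, ← hcz y⁻¹]
      calc _ = g * y * ((z ^ i)⁻¹ * g⁻¹) * y⁻¹ * z ^ i := by simp only [mul_assoc]
        _ = _ := by
          rw [hci]
          calc _ = g * y * g⁻¹ * ((z ^ i)⁻¹ * y⁻¹) * z ^ i := by simp only [mul_assoc]
            _ = _ := by rw [hci]; simp only [mul_assoc, inv_mul_cancel, mul_one]
    rw [this]; exact hcomm g
  · rw [map_mul, Module.End.mul_apply]
    have h3 : ρ (z ^ i)⁻¹ v = (ζ ^ i)⁻¹ • v := by
      have : ζ ^ i ≠ 0 := pow_ne_zero _ (hζ.ne_zero hp.ne_zero)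
      rw [eq_inv_smul_iff₀ this, ← map_smul, ← pow_smul_of hzs, ← Module.End.mul_apply, ← map_mul]; simp
    rw [h3, map_smul, hv.apply_eq_smul, hi, smul_smul, inv_mul_cancel₀, one_smul]
    rw [← hi]; exact pow_ne_zero _ (hζ.ne_zero hp.ne_zero)
lemma mem_fixz {Ω G V : Type} [Field Ω] [Group G] [AddCommGroup V] [Module Ω V]
    {ρ : Representation Ω G V} {y : G} {v : V} :
    v ∈ fixK ρ (Subgroup.zpowers y) ↔ ρ y v = v := by
  rw [mem_fixK, Subgroup.zpowers_le, mem_stab]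

lemma pair_stable {Ω G V : Type} [Field Ω] [Group G] [AddCommGroup V] [Module Ω V]
    (ρ : Representation Ω G V) (y : G) :
    ∀ h ∈ Subgroup.centralizer {y}, ∀ w ∈ fixK ρ (Subgroup.zpowers y), ρ h w ∈ fixK ρ (Subgroup.zpowers y) := by
  intro h hh w hw
  rw [mem_fixz] at hw ⊢
  rw [Subgroup.mem_centralizer_singleton_iff] at hh
  rw [← Module.End.mul_apply, ← map_mul, ← hh, map_mul, Module.End.mul_apply, hw]

lemma pair_twist {Ω G V : Type} [Field Ω] [Group G] [Finite G] [AddCommGroup V] [Module Ω V]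
    {p : ℕ} (hp : p.Prime) {ρ : Representation Ω G V} (hf : Function.Injective ρ)
    {z y : G} (hzo : orderOf z = p) {ζ : Ω} (hζ : IsPrimitiveRoot ζ p)
    (hzs : ∀ v, ρ z v = ζ • v)
    (hcomm : ∀ g, g * y * g⁻¹ * y⁻¹ ∈ Subgroup.zpowers z) (g : G) (hg : g ∉ Subgroup.centralizer {y}) :
    ∃ ω : Ω, ω ^ p = 1 ∧ ω ≠ 1 ∧ ∀ v, ρ y v = v → ρ y (ρ g v) = ω • ρ g v := by
  have h1 := hcomm g⁻¹
  rw [← mem_powers_iff_mem_zpowers] at h1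
  obtain ⟨i, hi⟩ := h1
  have hi : z ^ i = g⁻¹ * y * g * y⁻¹ := by simpa using hi
  have hyg : y * g = g * z ^ i * y := by rw [hi]; group
  refine ⟨ζ ^ i, ?_, ?_, ?_⟩
  · rw [← pow_mul, mul_comm, pow_mul, hζ.pow_eq_one, one_pow]
  · intro hc
    apply hg
    have : z ^ i = 1 := by
      apply hf; ext w; rw [pow_smul_of hzs, hc]; simp
    rw [Subgroup.mem_centralizer_singleton_iff, hyg, this, mul_one]
  · intro v hv
    rw [← Module.End.mul_apply, ← map_mul, hyg, map_mul, Module.End.mul_apply, hv, map_mul,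
      Module.End.mul_apply, pow_smul_of hzs, map_smul]

lemma pair_irr {Ω G V : Type} [Field Ω] [CharZero Ω] [Group G] [Finite G] [AddCommGroup V] [Module Ω V]
    {p : ℕ} (hp : p.Prime) {ρ : Representation Ω G V} (h : Irr' ρ) (hf : Function.Injective ρ)
    {z y : G} (hzo : orderOf z = p) {ζ : Ω} (hζ : IsPrimitiveRoot ζ p)
    (hzs : ∀ v, ρ z v = ζ • v)
    (hcomm : ∀ g, g * y * g⁻¹ * y⁻¹ ∈ Subgroup.zpowers z) {v : V} (hv : v ≠ 0) (hyv : ρ y v = v) :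
    Irr' (subRep ρ (Subgroup.centralizer {y}) (fixK ρ (Subgroup.zpowers y)) (pair_stable ρ y)) := by
  refine ⟨⟨⟨v, mem_fixz.2 hyv⟩, 0, fun hh => hv (congrArg Subtype.val hh)⟩, ?_⟩
  intro U hU
  by_cases hb : U = ⊥
  · exact Or.inl hb
  right
  set U' : Submodule Ω V := U.map (fixK ρ (Subgroup.zpowers y)).subtype with hU'
  have hUfix : ∀ u ∈ U', ρ y u = u := by
    rintro _ ⟨u, -, rfl⟩; exact mem_fixz.1 u.2
  have hUst : ∀ g ∈ Subgroup.centralizer {y}, ∀ u ∈ U', ρ g u ∈ U' := by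
    rintro g hg _ ⟨u, hu, rfl⟩
    exact ⟨_, hU ⟨g, hg⟩ u hu, rfl⟩
  set S : Submodule Ω V := ⨆ g : G, U'.map (ρ g) with hS
  have hStop : S = ⊤ := by
    refine (h.2 S ?_).resolve_left ?_
    · intro g x hx
      have : S ≤ S.comap (ρ g) := by
        refine iSup_le fun g' => ?_
        rintro _ ⟨u, hu, rfl⟩
        rw [Submodule.mem_comap, ← Module.End.mul_apply, ← map_mul]
        exact (le_iSup (fun g : G => U'.map (ρ g)) (g * g')) ⟨u, hu, rfl⟩
      exact this hx
    · intro hSb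
      apply hb
      rw [eq_bot_iff] at hSb ⊢
      intro u hu
      have h1 : (u : V) ∈ S := (le_iSup (fun g : G => U'.map (ρ g)) 1) ⟨u, ⟨u, hu, rfl⟩, by simp⟩
      have h2 := hSb h1
      rw [Submodule.mem_bot] at h2 ⊢
      exact Subtype.ext h2
  set e : V →ₗ[Ω] V := ∑ i ∈ Finset.range p, (ρ y) ^ i with he
  have hee : ∀ (ω : Ω) (u : V), ρ y u = ω • u → e u = (∑ i ∈ Finset.range p, ω ^ i) • u := by
    intro ω u hu
    rw [he, LinearMap.sum_apply, Finset.sum_smul]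
    refine Finset.sum_congr rfl fun i hi => ?_
    clear hi
    induction i with
    | zero => simp
    | succ n ih => rw [pow_succ, Module.End.mul_apply, hu, map_smul, ih, smul_smul, pow_succ, mul_comm]
  have hle : S ≤ U'.comap e := by
    refine iSup_le fun g => ?_
    rintro _ ⟨u, hu, rfl⟩
    rw [Submodule.mem_comap]
    by_cases hg : g ∈ Subgroup.centralizer {y}
    · have h1 := hUst g hg u hu
      rw [hee 1 _ (by rw [one_smul]; exact hUfix _ h1)]
      exact Submodule.smul_mem _ _ h1
    · obtain ⟨ω, h1, h2, h3⟩ := pair_twist hp hf hzo hζ hzs hcomm g hg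
      rw [hee ω _ (h3 u (hUfix u hu))]
      have : ∑ i ∈ Finset.range p, ω ^ i = 0 := by
        have := geom_sum_mul ω p
        rw [h1, sub_self] at this
        exact (mul_eq_zero.1 this).resolve_right (sub_ne_zero.2 h2)
      rw [this, zero_smul]; exact Submodule.zero_mem _
  rw [eq_top_iff]
  intro w _
  have h1 : (w : V) ∈ S := by rw [hStop]; trivial
  have h2 := hle h1
  rw [Submodule.mem_comap, hee 1 _ (by rw [one_smul]; exact mem_fixz.1 w.2)] at h2
  simp only [one_pow, Finset.sum_const, Finset.card_range, nsmul_eq_mul, mul_one] at h2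
  rw [Submodule.smul_mem_iff _ (Nat.cast_ne_zero.2 hp.ne_zero)] at h2
  obtain ⟨w', hw', h3⟩ := h2
  have : w' = w := Subtype.ext h3
  rwa [← this]

lemma pair_fixK {Ω G V : Type} [Field Ω] [Group G] [AddCommGroup V] [Module Ω V]
    (ρ : Representation Ω G V) (y : G) (K : Subgroup (Subgroup.centralizer {y})) :
    fixK ρ (K.map (Subgroup.centralizer {y}).subtype ⊔ Subgroup.zpowers y) =
    (fixK (subRep ρ (Subgroup.centralizer {y}) (fixK ρ (Subgroup.zpowers y)) (pair_stable ρ y)) K).map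
      (fixK ρ (Subgroup.zpowers y)).subtype := by
  ext v
  rw [mem_fixK, sup_le_iff]
  constructor
  · rintro ⟨h1, h2⟩
    refine ⟨⟨v, h2⟩, ?_, rfl⟩
    intro k hk
    rw [mem_stab]
    apply Subtype.ext
    exact h1 ⟨k, hk, rfl⟩
  · rintro ⟨w, hw, rfl⟩
    refine ⟨?_, w.2⟩
    rintro _ ⟨k, hk, rfl⟩
    exact congrArg Subtype.val (hw hk)
lemma sum_sub_eq {Ω G : Type} [Field Ω] [Group G] [Fintype G] (H : Subgroup G) [Fintype H] (F : G → Ω) :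
    ∑ h : H, F h = ∑ g : G, if g ∈ H then F g else 0 := by
  rw [← Finset.sum_filter]
  exact (Finset.sum_subtype _ (by simp) F).symm

lemma pair_fs {Ω G V : Type} [Field Ω] [CharZero Ω] [Group G] [Fintype G] [AddCommGroup V] [Module Ω V]
    [FiniteDimensional Ω V] {ρ : Representation Ω G V}
    {z y : G} (hz : ∀ g, z * g = g * z) (hzz : z * z = 1) (hzs : ∀ v, ρ z v = - v) (hyy : y * y = 1)
    (htw : ∀ g ∉ Subgroup.centralizer {y}, y * g = z * (g * y)) [Fintype (Subgroup.centralizer {y})]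
    {x : G} (hx : x ∉ Subgroup.centralizer {y})
    (hsum : ∑ g : Subgroup.centralizer {y}, LinearMap.trace Ω _
      ((subRep ρ (Subgroup.centralizer {y}) (fixK ρ (Subgroup.zpowers y)) (pair_stable ρ y)) (g * g)) =
      - (Fintype.card (Subgroup.centralizer {y}) : Ω)) :
    ∑ g : G, LinearMap.trace Ω V (ρ (g * g)) = -(Fintype.card G : Ω) := by
  set H := Subgroup.centralizer {y} with hH
  have hin : ∀ {g}, g ∈ H ↔ g * y = y * g := by
    intro g; rw [hH, Subgroup.mem_centralizer_singleton_iff]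
  have hyH : y ∈ H := hin.2 rfl
  have hmul : ∀ {a b : G}, a * b ∈ H ↔ (a ∈ H ↔ b ∈ H) := by
    intro a b
    by_cases ha : a ∈ H
    · rw [Subgroup.mul_mem_cancel_left _ ha]; tauto
    · by_cases hb : b ∈ H
      · rw [Subgroup.mul_mem_cancel_right _ hb]; tauto
      · simp only [ha, hb, iff_true]
        rw [hin]
        symm
        calc y * (a * b) = (y * a) * b := by rw [mul_assoc]
          _ = z * a * (y * b) := by rw [htw a ha]; simp only [mul_assoc]
          _ = z * (a * z) * b * y := by rw [htw b hb]; simp only [mul_assoc]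
          _ = a * b * y := by rw [← hz a, ← mul_assoc, hzz, one_mul]
  have hneg : ∀ g, ρ (z * g) = - ρ g := by
    intro g; ext w
    rw [map_mul, Module.End.mul_apply, hzs]; simp
  set t : G → Ω := fun g => LinearMap.trace Ω V (ρ g) with ht
  have htneg : ∀ g, t (z * g) = - t g := by
    intro g; simp only [ht, hneg, map_neg]
  have hS1 : ∑ g : G, (if g ∈ H then 0 else t (g * g)) = 0 := by
    have h1 := Equiv.sum_comp (Equiv.mulRight y) (fun g : G => if g ∈ H then 0 else t (g * g))
    have h2 : ∀ g : G, (if Equiv.mulRight y g ∈ H then 0 else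
          t (Equiv.mulRight y g * Equiv.mulRight y g)) =
          - (if g ∈ H then 0 else t (g * g)) := by
      intro g
      simp only [Equiv.coe_mulRight, Subgroup.mul_mem_cancel_right _ hyH]
      split_ifs with hg
      · simp
      · have : g * y * (g * y) = z * (g * g) := by
          calc g * y * (g * y) = g * (y * g) * y := by simp only [mul_assoc]
            _ = g * z * g * (y * y) := by rw [htw g hg]; simp only [mul_assoc]
            _ = _ := by rw [← hz g, hyy, mul_one, mul_assoc]
        rw [this, htneg]
    simp only [h2, Finset.sum_neg_distrib] at h1
    exact self_eq_neg.1 h1.symm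
  have hS2 : ∑ g : G, (if g ∈ H then t (g * g * y) else 0) = 0 := by
    have h1 := Equiv.sum_comp (MulAut.conj x⁻¹).toEquiv (fun g : G => if g ∈ H then t (g * g * y) else 0)
    have h2 : ∀ g : G, (if (MulAut.conj x⁻¹).toEquiv g ∈ H then
          t ((MulAut.conj x⁻¹).toEquiv g * (MulAut.conj x⁻¹).toEquiv g * y) else 0) =
          - (if g ∈ H then t (g * g * y) else 0) := by
      intro g
      have e1 : (MulAut.conj x⁻¹).toEquiv g = x⁻¹ * g * x := by simp
      rw [e1]
      have e2 : x⁻¹ * g * x ∈ H ↔ g ∈ H := by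
        rw [hmul, hmul, inv_mem_iff]; tauto
      simp only [e2]
      split_ifs with hg
      · have e3 : x * y = z * y * x := by
          rw [mul_assoc, htw x hx, ← mul_assoc, hzz, one_mul]
        have : t (x⁻¹ * g * x * (x⁻¹ * g * x) * y) = t (z * (g * g * y)) := by
          have : x⁻¹ * g * x * (x⁻¹ * g * x) * y = x⁻¹ * ((z * (g * g * y)) * x) := by
            calc _ = x⁻¹ * g * g * (x * y) := by group
              _ = x⁻¹ * (g * g * z) * y * x := by rw [e3]; simp only [mul_assoc]
              _ = _ := by rw [← hz]; simp only [mul_assoc]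
          rw [this]
          simp only [ht]
          rw [map_mul, LinearMap.trace_mul_comm, ← map_mul, mul_assoc, mul_inv_cancel, mul_one]
        rw [this, htneg]
      · simp
    simp only [h2, Finset.sum_neg_distrib] at h1
    exact self_eq_neg.1 h1.symm
  have hcount : (2 : Ω) * ∑ g : G, (if g ∈ H then (1:Ω) else 0) = Fintype.card G := by
    have h1 := Equiv.sum_comp (Equiv.mulRight x)
      (fun g : G => if g ∈ H then (1:Ω) else 0)
    have h2 : ∀ g : G, (if Equiv.mulRight x g ∈ H then (1:Ω) else 0) =
        1 - (if g ∈ H then (1:Ω) else 0) := by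
      intro g
      simp only [Equiv.coe_mulRight, hmul, hx, iff_false]
      split_ifs <;> simp
    simp only [h2, Finset.sum_sub_distrib] at h1
    simp only [Finset.sum_const, Finset.card_univ, nsmul_eq_mul] at h1
    linear_combination - h1
  have htr : ∀ g : H, 2 * LinearMap.trace Ω _
      ((subRep ρ H (fixK ρ (Subgroup.zpowers y)) (pair_stable ρ y)) (g * g)) =
      t (g * g) + t (g * g * y) := by
    intro g
    set f : V →ₗ[Ω] V := ρ ((g : G) * g) ∘ₗ (1 + ρ y) with hfdef
    have hf1 : ∀ v, f v ∈ fixK ρ (Subgroup.zpowers y) := by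
      intro v
      apply pair_stable ρ y
      · exact H.mul_mem g.2 g.2
      · rw [mem_fixz]
        simp only [LinearMap.add_apply, Module.End.one_apply, map_add]
        rw [← Module.End.mul_apply, ← map_mul, hyy, map_one, Module.End.one_apply, add_comm]
    have h1 := LinearMap.trace_restrict_eq_of_forall_mem (fixK ρ (Subgroup.zpowers y)) f hf1
    have h2 : f.restrict (fun v _ => hf1 v) = (2 : Ω) •
       ((subRep ρ H (fixK ρ (Subgroup.zpowers y)) (pair_stable ρ y)) (g * g)) := by
      ext w
      have := mem_fixz.1 w.2
      change f w = (2:Ω) • ρ ((g : G) * g) w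
      simp only [hfdef, LinearMap.comp_apply, LinearMap.add_apply, Module.End.one_apply, this]
      rw [← two_smul Ω, map_smul]
    rw [h2, map_smul, smul_eq_mul] at h1
    rw [h1]
    simp only [hfdef, ht]
    rw [← map_add]
    congr 1
    ext v; simp [map_mul]
  have h3 : (2:Ω) * ∑ g : H, LinearMap.trace Ω _
      ((subRep ρ H (fixK ρ (Subgroup.zpowers y)) (pair_stable ρ y)) (g * g)) =
      ∑ g : G, t (g * g) := by
    rw [Finset.mul_sum, Finset.sum_congr rfl (fun g _ => htr g),
      sum_sub_eq H (fun g => t (g * g) + t (g * g * y))]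
    have : ∀ g : G, (if g ∈ H then t (g * g) + t (g * g * y) else 0) =
      t (g * g) - (if g ∈ H then 0 else t (g * g)) + (if g ∈ H then t (g * g * y) else 0) := by
      intro g; split_ifs <;> simp
    rw [Finset.sum_congr rfl (fun g _ => this g), Finset.sum_add_distrib, Finset.sum_sub_distrib, hS1, hS2]
    simp
  have h4 : (Fintype.card H : Ω) = ∑ g : G, (if g ∈ H then (1:Ω) else 0) := by
    rw [← sum_sub_eq H (fun _ => (1:Ω))]; simp
  change ∑ g : G, t (g * g) = _
  have hsum' : ∑ g : H, LinearMap.trace Ω _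
      ((subRep ρ H (fixK ρ (Subgroup.zpowers y)) (pair_stable ρ y)) (g * g)) =
      - (Fintype.card H : Ω) := by convert hsum
  rw [← h3, hsum', h4, ← hcount]; ring

lemma good_pair {Ω G V : Type} [Field Ω] [IsAlgClosed Ω] [CharZero Ω] [Group G] [Fintype G]
    [AddCommGroup V] [Module Ω V] [FiniteDimensional Ω V] {p : ℕ} (hp : p.Prime)
    {ρ : Representation Ω G V} (h : Irr' ρ)
    (hf : Function.Injective ρ) (hP : HasPair p G)
    (IH : ∀ (H : Subgroup G), H ≠ ⊤ → ∀ (W : Submodule Ω V) (σ : Representation Ω H W), Irr' σ → Good p σ) :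
    Good p ρ := by
  obtain ⟨z, y, hz, hzo, hy, hyz, hcomm⟩ := hP
  obtain ⟨ζ, hζ, hzs⟩ := prim_of hp h hf hz hzo
  obtain ⟨y, hy, hyz, hcomm, v, hv, hyv⟩ := pair_fix hp h hz hzo hζ hzs hy hyz hcomm
  have hne : Subgroup.centralizer {y} ≠ (⊤ : Subgroup G) := by
    intro ht
    apply hyz
    have hcen : ∀ g, y * g = g * y := by
      intro g
      have : g ∈ Subgroup.centralizer {y} := by rw [ht]; trivial
      rw [Subgroup.mem_centralizer_singleton_iff] at this
      exact this.symm
    obtain ⟨c, hc⟩ := central_scalar h hcen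
    have h1 : c = 1 := by
      apply smul_left_injective Ω hv
      change c • v = (1:Ω) • v
      rw [← hc, hyv, one_smul]
    have : y = 1 := by
      apply hf; ext w; rw [hc, h1]; simp
    rw [this]; exact Subgroup.one_mem _
  obtain ⟨K, hK⟩ := IH _ hne _ _ (pair_irr hp h hf hzo hζ hzs hcomm hv hyv)
  refine ⟨K.map (Subgroup.centralizer {y}).subtype ⊔ Subgroup.zpowers y, ?_⟩
  rw [pair_fixK, Submodule.finrank_map_subtype_eq]
  refine hK.imp id ?_
  rintro ⟨h1, rfl, h3⟩
  refine ⟨h1, rfl, ?_⟩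
  have hzz : z * z = 1 := by rw [← pow_two, ← hzo, pow_orderOf_eq_one]
  have hz1 : z ≠ 1 := by
    intro hh; rw [hh, orderOf_one] at hzo; exact absurd hzo (by norm_num)
  have hzc : ∀ g, z * g = g * z := fun g => (Subgroup.mem_center_iff.1 hz g).symm
  obtain ⟨x, hx⟩ : ∃ x, x ∉ Subgroup.centralizer {y} := by
    by_contra! hcon
    exact hne (by rw [eq_top_iff]; intro g _; exact hcon g)
  refine pair_fs hzc hzz (neg_one_of h hf hz hz1 hzz) (by rw [← pow_two]; exact hy) ?_ hx h3
  intro g hg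
  have h4 := hcomm g⁻¹
  rw [← mem_powers_iff_mem_zpowers] at h4
  obtain ⟨i, hi⟩ := h4
  have hi : z ^ i = g⁻¹ * y * g * y⁻¹ := by simpa using hi
  have hyg : y * g = g * z ^ i * y := by rw [hi]; group
  rcases Nat.even_or_odd i with ⟨j, hj⟩ | ⟨j, hj⟩
  · exfalso
    apply hg
    rw [Subgroup.mem_centralizer_singleton_iff, hyg, hj, ← two_mul, pow_mul, pow_two, hzz]; simp
  · rw [hyg, hj, pow_succ, pow_mul, pow_two, hzz, one_pow, one_mul, ← hzc, mul_assoc]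
lemma sum_quot {Ω G Q : Type} [Field Ω] [Group G] [Fintype G] [Group Q] [Fintype Q] (π : G →* Q)
    (hπ : Function.Surjective π) : ∃ N : ℕ, ∀ f : Q → Ω, ∑ g : G, f (π g) = N * ∑ q : Q, f q := by
  refine ⟨(Finset.univ.filter (fun g => π g = 1)).card, fun f => ?_⟩
  rw [← Finset.sum_fiberwise_of_maps_to (s := Finset.univ) (t := Finset.univ) (g := π) (by simp),
    Finset.mul_sum]
  refine Finset.sum_congr rfl fun q _ => ?_
  have h1 : ∀ g ∈ Finset.univ.filter (fun g => π g = q), f (π g) = f q := by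
    intro g hg; rw [(Finset.mem_filter.1 hg).2]
  rw [Finset.sum_congr rfl h1, Finset.sum_const, nsmul_eq_mul]
  congr 2
  exact MonoidHom.card_fiber_eq_of_mem_range π (hπ q) (hπ 1)

lemma good_quot {Ω G V : Type} [Field Ω] [Group G] [Fintype G]
    [AddCommGroup V] [Module Ω V] {p : ℕ} 
    {ρ : Representation Ω G V} (h : Irr' ρ) (N : Subgroup G) [N.Normal] [Fintype (G ⧸ N)] (σ : Representation Ω (G ⧸ N) V)
    (hσ : ∀ g, σ (QuotientGroup.mk' N g) = ρ g) (IH : Irr' σ → Good p σ) : Good p ρ := by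
  obtain ⟨K, hK⟩ := IH ⟨h.1, fun U hU => h.2 U fun g x hx => by rw [← hσ]; exact hU _ x hx⟩
  refine ⟨K.comap (QuotientGroup.mk' N), ?_⟩
  have e1 : fixK ρ (K.comap (QuotientGroup.mk' N)) = fixK σ K := by
    ext v
    rw [mem_fixK, mem_fixK]
    constructor
    · intro h1 q hq
      obtain ⟨g, rfl⟩ := QuotientGroup.mk'_surjective N q
      rw [mem_stab, hσ]; exact h1 hq
    · intro h1 g hg
      rw [mem_stab, ← hσ]; exact h1 hg
  rw [e1]
  refine hK.imp id ?_
  rintro ⟨h1, h2, h3⟩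
  refine ⟨h1, h2, ?_⟩
  obtain ⟨M, hM⟩ := sum_quot (Ω := Ω) (QuotientGroup.mk' N) (QuotientGroup.mk'_surjective N)
  have h4 := hM (fun _ => 1)
  simp only [Finset.sum_const, Finset.card_univ, nsmul_eq_mul, mul_one] at h4
  have h5 := hM (fun q => LinearMap.trace Ω V (σ (q * q)))
  simp only [← map_mul, hσ] at h5
  rw [h5, h3, h4]; ring

theorem star_thm {Ω : Type} [Field Ω] [IsAlgClosed Ω] [CharZero Ω] {p : ℕ} (hp : p.Prime) (n : ℕ) :
    ∀ (G V : Type) [Group G] [Fintype G] (_ : IsPGroup p G) (_ : Nat.card G = n)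
    [AddCommGroup V] [Module Ω V] [FiniteDimensional Ω V]
    (ρ : Representation Ω G V) (_ : Irr' ρ), Good p ρ := by
  induction n using Nat.strong_induction_on with
  | _ n IH =>
  intro G V _ _ hG hn _ _ _ ρ h
  by_cases hf : Function.Injective ρ
  · by_cases hP : HasPair p G
    · refine good_pair hp h hf hP ?_
      intro H hH W σ hσ
      refine IH (Nat.card H) ?_ H W (hG.to_subgroup H) rfl σ hσ
      rw [← hn]
      refine lt_of_le_of_ne (Subgroup.card_le_card_group H) fun he => hH ?_
      exact Subgroup.eq_top_of_card_eq H he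
    · by_cases hc : ∀ x y : G, x * y = y * x
      · exact good_abelian p h hc
      · have := Fact.mk hp
        obtain ⟨rfl, a, z, c, h1, h2, h3, h4, h5, h6, h7⟩ := roq_struct hG hP hc
        exact good_roq h hf hc h1 h2 h3 h4 h5 h6 h7
  · let N : Subgroup G := MonoidHom.ker ρ
    let σ : Representation Ω (G ⧸ N) V := QuotientGroup.lift N ρ (fun g hg => hg)
    have hσ : ∀ g, σ (QuotientGroup.mk' N g) = ρ g := fun g => QuotientGroup.lift_mk' N _ g
    letI : Fintype (G ⧸ N) := Fintype.ofFinite _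
    refine good_quot h N σ hσ ?_
    refine fun hσ => IH (Nat.card (G ⧸ N)) ?_ (G ⧸ N) V (hG.to_quotient N) rfl σ hσ
    have hN : N ≠ ⊥ := fun hb => hf ((MonoidHom.ker_eq_bot_iff ρ).1 hb)
    have h1 := Subgroup.card_eq_card_quotient_mul_card_subgroup N
    have h2 := (Subgroup.one_lt_card_iff_ne_bot N).2 hN
    have h3 : 0 < Nat.card (G ⧸ N) := Nat.card_pos
    rw [← hn, h1]
    nlinarith
open scoped TensorProduct in
def bc {k : Type} (Ω : Type) {G V : Type} [Field k] [Field Ω] [Algebra k Ω] [Group G] [AddCommGroup V]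
    [Module k V] (ρ : Representation k G V) : Representation Ω G (Ω ⊗[k] V) where
  toFun g := (ρ g).baseChange Ω
  map_one' := by rw [map_one]; exact LinearMap.baseChange_id
  map_mul' := by intro a b; rw [map_mul]; exact LinearMap.baseChange_comp _ _

lemma bc_tmul {k Ω G V : Type} [Field k] [Field Ω] [Algebra k Ω] [Group G] [AddCommGroup V]
    [Module k V] (ρ : Representation k G V) (g : G) (a : Ω) (v : V) :
    bc Ω ρ g (TensorProduct.tmul k a v) = TensorProduct.tmul k a (ρ g v) := rfl

lemma bc_char {k Ω G V : Type} [Field k] [Field Ω] [Algebra k Ω] [Group G] [AddCommGroup V]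
    [Module k V] [FiniteDimensional k V] (ρ : Representation k G V) (g : G) :
    LinearMap.trace Ω _ (bc Ω ρ g) = algebraMap k Ω (LinearMap.trace k V (ρ g)) :=
  LinearMap.trace_baseChange _ _

def Hm {Ω G V W : Type} [Field Ω] [Group G] [AddCommGroup V] [Module Ω V] [AddCommGroup W] [Module Ω W]
    (ρ : Representation Ω G V) (σ : Representation Ω G W) : Submodule Ω (V →ₗ[Ω] W) where
  carrier := {f | ∀ g v, f (ρ g v) = σ g (f v)}
  zero_mem' := by intro g v; simp
  add_mem' := by intro a b ha hb g v; simp [ha g v, hb g v]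
  smul_mem' := by intro c a ha g v; simp [ha g v]

lemma mem_Hm {Ω G V W : Type} [Field Ω] [Group G] [AddCommGroup V] [Module Ω V] [AddCommGroup W] [Module Ω W]
    {ρ : Representation Ω G V} {σ : Representation Ω G W} {f : V →ₗ[Ω] W} :
    f ∈ Hm ρ σ ↔ ∀ g v, f (ρ g v) = σ g (f v) := Iff.rfl

lemma hd_char {Ω G V W : Type} [Field Ω] [CharZero Ω] [Group G] [Fintype G] [AddCommGroup V] [Module Ω V]
    [AddCommGroup W] [Module Ω W] [FiniteDimensional Ω V] [FiniteDimensional Ω W]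
    (ρ : Representation Ω G V) (σ : Representation Ω G W) :
    (Module.finrank Ω (Hm ρ σ) : Ω) =
      (Nat.card G : Ω)⁻¹ * ∑ g : G, LinearMap.trace Ω W (σ g) * LinearMap.trace Ω V (ρ g⁻¹) := by
  have hne : (Nat.card G : Ω) ≠ 0 := Nat.cast_ne_zero.2 Nat.card_pos.ne'
  let := invertibleOfNonzero hne
  have h1 := Representation.card_inv_mul_sum_char_mul_char_eq_finrank ρ σ
  refine Eq.trans ?_ h1.symm
  congr 1
  let e : Hm ρ σ ≃ₗ[Ω] Representation.IntertwiningMap ρ σ :=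
    { toFun := fun f => ⟨f.1, fun g => by ext v; exact f.2 g v⟩
      invFun := fun f => ⟨f.toLinearMap, fun g v => Representation.IntertwiningMap.isIntertwining ρ σ f g v⟩
      map_add' := fun _ _ => rfl
      map_smul' := fun _ _ => rfl
      left_inv := fun _ => rfl
      right_inv := fun _ => rfl }
  exact e.finrank_eq

/-- additivity in the first variable -/
lemma hd_add {Ω G A B C V : Type} [Field Ω] [CharZero Ω] [Group G] [Fintype G]
    [AddCommGroup A] [Module Ω A] [FiniteDimensional Ω A]
    [AddCommGroup B] [Module Ω B] [FiniteDimensional Ω B]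
    [AddCommGroup C] [Module Ω C] [FiniteDimensional Ω C]
    [AddCommGroup V] [Module Ω V] [FiniteDimensional Ω V]
    (α : Representation Ω G A) (β : Representation Ω G B) (γ : Representation Ω G C)
    (σ : Representation Ω G V) (m : ℕ)
    (h : ∀ g, LinearMap.trace Ω A (α g) = m * LinearMap.trace Ω B (β g) + LinearMap.trace Ω C (γ g)) :
    Module.finrank Ω (Hm α σ) = m * Module.finrank Ω (Hm β σ) + Module.finrank Ω (Hm γ σ) := by
  have : (Module.finrank Ω (Hm α σ) : Ω) =
    ((m * Module.finrank Ω (Hm β σ) + Module.finrank Ω (Hm γ σ) : ℕ) : Ω) := by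
    push_cast
    rw [hd_char, hd_char, hd_char, mul_left_comm, ← mul_add]
    congr 1
    rw [Finset.mul_sum, ← Finset.sum_add_distrib]
    refine Finset.sum_congr rfl fun g _ => ?_
    rw [h]; ring
  exact_mod_cast this

lemma hm_surj {Ω G V W : Type} [Field Ω] [Group G] [AddCommGroup V] [Module Ω V] [AddCommGroup W] [Module Ω W]
    {ρ : Representation Ω G V} {σ : Representation Ω G W} (h : Irr' σ) {f : V →ₗ[Ω] W} (hf : f ∈ Hm ρ σ)
    (h0 : f ≠ 0) : Function.Surjective f := by
  rw [← LinearMap.range_eq_top]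
  refine (h.2 _ ?_).resolve_left ?_
  · rintro g _ ⟨v, rfl⟩
    exact ⟨ρ g v, hf g v⟩
  · rwa [LinearMap.range_eq_bot]

lemma avg_mem {Ω G V W : Type} [Field Ω] [Group G] [Fintype G] [AddCommGroup V] [Module Ω V]
    [AddCommGroup W] [Module Ω W] (ρ : Representation Ω G V) (σ : Representation Ω G W) (f : V →ₗ[Ω] W) :
    ∑ g : G, σ g ∘ₗ f ∘ₗ ρ g⁻¹ ∈ Hm ρ σ := by
  intro x v
  simp only [LinearMap.sum_apply, LinearMap.comp_apply, map_sum]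
  rw [← Equiv.sum_comp (Equiv.mulLeft x)]
  refine Finset.sum_congr rfl fun g _ => ?_
  simp only [Equiv.coe_mulLeft, map_mul, Module.End.mul_apply, mul_inv_rev]
  congr 3
  rw [← Module.End.mul_apply, ← map_mul]; simp

lemma exists_quot {Ω G V : Type} [Field Ω] [Group G] [AddCommGroup V] [Module Ω V] [FiniteDimensional Ω V]
    [Nontrivial V] (ρ : Representation Ω G V) :
    ∃ (W : Submodule Ω V) (σ : Representation Ω G (V ⧸ W)), Irr' σ ∧ W.mkQ ∈ Hm ρ σ ∧ W.mkQ ≠ 0 := by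
  obtain ⟨W, ⟨hW1, hW2⟩, hmax⟩ := (wellFounded_gt (α := Submodule Ω V)).has_min
    {W | (∀ g, ∀ x ∈ W, ρ g x ∈ W) ∧ W ≠ ⊤} ⟨⊥, by
      intro g x hx; rw [Submodule.mem_bot] at hx ⊢; rw [hx, map_zero], bot_ne_top⟩
  let σ : Representation Ω G (V ⧸ W) :=
    { toFun := fun g => W.mapQ W (ρ g) (fun x hx => hW1 g x hx)
      map_one' := by ext x; simp
      map_mul' := by intro a b; ext x; simp }
  have hmem : W.mkQ ∈ Hm ρ σ := fun g v => rfl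
  have hnt : Nontrivial (V ⧸ W) := Submodule.Quotient.nontrivial_iff.2 hW2
  refine ⟨W, σ, ⟨hnt, ?_⟩, hmem, ?_⟩
  · intro U hU
    by_cases ht : U = ⊤
    · exact Or.inr ht
    left
    have h1 := hmax (U.comap W.mkQ) ⟨fun g x hx => by
      rw [Submodule.mem_comap, hmem]; exact hU g _ hx, fun hh => ht (by
        rw [eq_top_iff]; intro q _
        obtain ⟨v, rfl⟩ := W.mkQ_surjective q
        have : v ∈ U.comap W.mkQ := by rw [hh]; trivial
        exact this)⟩
    have h2 : W ≤ U.comap W.mkQ := by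
      intro w hw
      rw [Submodule.mem_comap, (Submodule.Quotient.mk_eq_zero W).2 hw |> (show W.mkQ w = 0 from ·)]
      exact U.zero_mem
    have h3 : W = U.comap W.mkQ := by
      by_contra hne
      exact h1 (lt_of_le_of_ne h2 hne)
    rw [eq_bot_iff]
    intro q hq
    obtain ⟨v, rfl⟩ := W.mkQ_surjective q
    have : v ∈ W := by rw [h3]; exact hq
    exact (Submodule.Quotient.mk_eq_zero W).2 this
  · intro h0
    obtain ⟨q, hq⟩ := exists_ne (0 : V ⧸ W)
    obtain ⟨v, rfl⟩ := W.mkQ_surjective q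
    exact hq (by rw [h0]; rfl)
/-- the injectivity argument -/
lemma hd_le {k Ω G P V : Type} [Field k] [Field Ω] [CharZero Ω] [Algebra k Ω] [Group G] [Fintype G]
    [AddCommGroup P] [Module k P] [AddCommGroup V] [Module Ω V] [FiniteDimensional Ω V]
    {ρ : Representation k G P} (hρ : Irr' ρ) {σ : Representation Ω G V} (hσ : Irr' σ)
    (K : Subgroup G) (hK : fixK σ K ≠ ⊥) :
    Module.finrank Ω (Hm (bc Ω ρ) σ) ≤ Module.finrank Ω (fixK σ K) := by
  by_cases hw : ∃ w ∈ fixK ρ K, w ≠ 0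
  · obtain ⟨w, hw, hw0⟩ := hw
    let Φ : Hm (bc Ω ρ) σ →ₗ[Ω] fixK σ K :=
      { toFun := fun f => ⟨f.1 (TensorProduct.tmul k 1 w), fun g hg => by
          rw [mem_stab, ← f.2, bc_tmul]; rw [mem_stab.1 (hw hg)]⟩
        map_add' := fun _ _ => rfl
        map_smul' := fun _ _ => rfl }
    apply LinearMap.finrank_le_finrank_of_injective (f := Φ)
    rw [← LinearMap.ker_eq_bot, LinearMap.ker_eq_bot']
    intro f hf
    have hf : f.1 (TensorProduct.tmul k 1 w) = 0 := congrArg Subtype.val hf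
    let U : Submodule k P :=
      { carrier := {v | f.1 (TensorProduct.tmul k 1 v) = 0}
        zero_mem' := by
          change f.1 (TensorProduct.tmul k 1 0) = 0
          rw [TensorProduct.tmul_zero, map_zero]
        add_mem' := by
          intro a b (ha : f.1 (TensorProduct.tmul k 1 a) = 0) (hb : f.1 (TensorProduct.tmul k 1 b) = 0)
          change f.1 (TensorProduct.tmul k 1 (a + b)) = 0
          rw [TensorProduct.tmul_add, map_add, ha, hb, add_zero]
        smul_mem' := by
          intro c a (ha : f.1 (TensorProduct.tmul k 1 a) = 0)
          change f.1 (TensorProduct.tmul k 1 (c • a)) = 0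
          have : TensorProduct.tmul k (1:Ω) (c • a) = (algebraMap k Ω c) • TensorProduct.tmul k (1:Ω) a := by
            rw [TensorProduct.smul_tmul', ← TensorProduct.smul_tmul, smul_eq_mul, mul_one, Algebra.algebraMap_eq_smul_one]
          rw [this, map_smul, ha, smul_zero] }
    have hU : U = ⊤ := by
      refine (hρ.2 U ?_).resolve_left ?_
      · intro g x (hx : f.1 (TensorProduct.tmul k 1 x) = 0)
        change f.1 (TensorProduct.tmul k 1 (ρ g x)) = 0
        rw [← bc_tmul, f.2, hx, map_zero]
      · intro hb
        have : w ∈ U := hf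
        rw [hb, Submodule.mem_bot] at this
        exact hw0 this
    apply Subtype.ext
    apply LinearMap.ext
    intro x
    change f.1 x = 0
    induction x using TensorProduct.induction_on with
    | zero => simp
    | add a b ha hb => rw [map_add, ha, hb, add_zero]
    | tmul a v =>
      have h1 : v ∈ U := by rw [hU]; trivial
      have h1 : f.1 (TensorProduct.tmul k 1 v) = 0 := h1
      have : TensorProduct.tmul k a v = a • TensorProduct.tmul k (1:Ω) v := by
        rw [TensorProduct.smul_tmul', smul_eq_mul, mul_one]
      rw [this, map_smul, h1, smul_zero]
  · push Not at hw
    have h0 : Hm (bc Ω ρ) σ = ⊥ := by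
      rw [eq_bot_iff]
      intro f hf
      rw [Submodule.mem_bot]
      by_contra hf0
      have hs := hm_surj hσ hf hf0
      apply hK
      rw [eq_bot_iff]
      intro v hv
      obtain ⟨u, rfl⟩ := hs v
      have h1 : ∀ x : P, ∑ g : K, ρ g x = 0 := by
        intro x
        apply hw
        intro g hg
        rw [mem_stab, map_sum, ← Equiv.sum_comp (Equiv.mulLeft (⟨g, hg⟩ : K)) (fun h : K => ρ h x)]
        refine Finset.sum_congr rfl fun h _ => ?_
        simp
      have h2 : ∀ u, ∑ g : K, bc Ω ρ g u = 0 := by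
        intro u
        induction u using TensorProduct.induction_on with
        | zero => simp
        | add a b ha hb => simp only [map_add, Finset.sum_add_distrib, ha, hb, add_zero]
        | tmul a x =>
          simp only [bc_tmul]
          rw [← TensorProduct.tmul_sum, h1, TensorProduct.tmul_zero]
      have h3 : ∑ g : K, f (bc Ω ρ g u) = (Fintype.card K : Ω) • f u := by
        have h4 : ∀ g : K, f (bc Ω ρ g u) = f u := fun g => (hf g u).trans (hv g.2)
        rw [Finset.sum_congr rfl (fun g _ => h4 g)]
        rw [Finset.sum_const, Finset.card_univ, Nat.cast_smul_eq_nsmul]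
      rw [← map_sum, h2, map_zero] at h3
      rw [Submodule.mem_bot]
      exact (smul_eq_zero.1 h3.symm).resolve_left (Nat.cast_ne_zero.2 Fintype.card_pos.ne')
    rw [h0, finrank_bot]; exact Nat.zero_le _

/-- base changes of endomorphisms span -/
lemma bc_span {k Ω P : Type} [Field k] [Field Ω] [Algebra k Ω] 
    [AddCommGroup P] [Module k P] [FiniteDimensional k P] 
    (S : TensorProduct k Ω P →ₗ[Ω] TensorProduct k Ω P) :
    S ∈ Submodule.span Ω (Set.range fun T : P →ₗ[k] P => T.baseChange Ω) := by
  let b := Module.finBasis k P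
  let B := Algebra.TensorProduct.basis Ω b
  have : S = ∑ i, ∑ j, (B.repr (S (B j)) i) • (((b.coord j).smulRight (b i)).baseChange Ω) := by
    apply B.ext
    intro l
    simp only [LinearMap.sum_apply, LinearMap.smul_apply]
    conv_lhs => rw [← B.sum_repr (S (B l))]
    refine Finset.sum_congr rfl fun i _ => ?_
    rw [Finset.sum_eq_single l]
    · congr 1
      simp [B, Algebra.TensorProduct.basis_apply]
    · intro j _ hj
      simp [B, Algebra.TensorProduct.basis_apply, hj.symm]
    · simp
  rw [this]
  refine Submodule.sum_mem _ fun i _ => Submodule.sum_mem _ fun j _ => Submodule.smul_mem _ _ ?_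
  exact Submodule.subset_span ⟨_, rfl⟩

lemma end_span {k Ω G P : Type} [Field k] [Field Ω] [CharZero Ω] [Algebra k Ω] [Group G] [Fintype G]
    [AddCommGroup P] [Module k P] [FiniteDimensional k P] (ρ : Representation k G P)
    (S : TensorProduct k Ω P →ₗ[Ω] TensorProduct k Ω P) (hS : S ∈ Hm (bc Ω ρ) (bc Ω ρ)) :
    S ∈ Submodule.span Ω ((fun T : P →ₗ[k] P => T.baseChange Ω) '' (Hm ρ ρ : Set (P →ₗ[k] P))) := by
  have key : ∀ S ∈ Submodule.span Ω (Set.range fun T : P →ₗ[k] P => T.baseChange Ω),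
      ∑ g : G, bc Ω ρ g ∘ₗ S ∘ₗ bc Ω ρ g⁻¹ ∈
      Submodule.span Ω ((fun T : P →ₗ[k] P => T.baseChange Ω) '' (Hm ρ ρ : Set (P →ₗ[k] P))) := by
    intro S hS
    induction hS using Submodule.span_induction with
    | mem x hx =>
      obtain ⟨T, rfl⟩ := hx
      apply Submodule.subset_span
      refine ⟨_, avg_mem ρ ρ T, ?_⟩
      change LinearMap.baseChange Ω (∑ g : G, ρ g ∘ₗ T ∘ₗ ρ g⁻¹) = _
      apply TensorProduct.AlgebraTensorModule.ext
      intro a v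
      simp only [LinearMap.baseChange_tmul, LinearMap.sum_apply, LinearMap.comp_apply, bc_tmul,
        TensorProduct.tmul_sum]
    | zero => simp
    | add x y _ _ hx hy =>
      simp only [LinearMap.add_comp, LinearMap.comp_add, Finset.sum_add_distrib]
      exact Submodule.add_mem _ hx hy
    | smul c x _ hx =>
      simp only [LinearMap.smul_comp, LinearMap.comp_smul, ← Finset.smul_sum]
      exact Submodule.smul_mem _ _ hx
  have h1 := key S (bc_span S)
  have h2 : ∑ g : G, bc Ω ρ g ∘ₗ S ∘ₗ bc Ω ρ g⁻¹ = (Fintype.card G : Ω) • S := by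
    have : ∀ g : G, bc Ω ρ g ∘ₗ S ∘ₗ bc Ω ρ g⁻¹ = S := by
      intro g
      apply LinearMap.ext
      intro v
      rw [LinearMap.comp_apply, LinearMap.comp_apply, hS, ← Module.End.mul_apply, ← map_mul]; simp
    rw [Finset.sum_congr rfl (fun g _ => this g), Finset.sum_const, Finset.card_univ, Nat.cast_smul_eq_nsmul]
  rw [h2] at h1
  exact (Submodule.smul_mem_iff _ (Nat.cast_ne_zero.2 Fintype.card_pos.ne')).1 h1

lemma end_comm {k Ω G P : Type} [Field k] [Field Ω] [CharZero Ω] [Algebra k Ω] [Group G] [Fintype G]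
    [AddCommGroup P] [Module k P] [FiniteDimensional k P] (ρ : Representation k G P)
    (hD : ∀ S ∈ Hm ρ ρ, ∀ T ∈ Hm ρ ρ, S ∘ₗ T = T ∘ₗ S)
    (S T : TensorProduct k Ω P →ₗ[Ω] TensorProduct k Ω P) (hS : S ∈ Hm (bc Ω ρ) (bc Ω ρ))
    (hT : T ∈ Hm (bc Ω ρ) (bc Ω ρ)) : S ∘ₗ T = T ∘ₗ S := by
  have h1 := end_span ρ S hS
  have h2 := end_span ρ T hT
  set X := (fun T : P →ₗ[k] P => T.baseChange Ω) '' (Hm ρ ρ : Set (P →ₗ[k] P)) with hX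
  have h3 : ∀ A ∈ X, ∀ B ∈ X, Commute (A : Module.End Ω (TensorProduct k Ω P)) B := by
    rintro _ ⟨A, hA, rfl⟩ _ ⟨B, hB, rfl⟩
    change LinearMap.baseChange Ω A ∘ₗ LinearMap.baseChange Ω B = LinearMap.baseChange Ω B ∘ₗ LinearMap.baseChange Ω A
    rw [← LinearMap.baseChange_comp, ← LinearMap.baseChange_comp, hD A hA B hB]
  have h4 : ∀ A ∈ X, ∀ B ∈ Submodule.span Ω X, Commute (A : Module.End Ω (TensorProduct k Ω P)) B := by
    intro A hA B hB
    induction hB using Submodule.span_induction with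
    | zero => exact Commute.zero_right _
    | add x y _ _ hx hy => exact hx.add_right hy
    | smul c x _ hx => exact hx.smul_right c
    | mem x hx => exact h3 A hA x hx
  have h5 : ∀ A ∈ Submodule.span Ω X, ∀ B ∈ Submodule.span Ω X,
      Commute (A : Module.End Ω (TensorProduct k Ω P)) B := by
    intro A hA B hB
    induction hA using Submodule.span_induction with
    | zero => exact Commute.zero_left _
    | add x y _ _ hx hy => exact hx.add_left hy
    | smul c x _ hx => exact hx.smul_left c
    | mem x hx => exact h4 x hx B hB
  exact h5 S h1 T h2

/-- commutative endomorphism ring forces multiplicity at most one -/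
lemma hd_le_one {Ω G P V : Type} [Field Ω] [IsAlgClosed Ω] [CharZero Ω] [Group G] [Fintype G]
    [AddCommGroup P] [Module Ω P] [AddCommGroup V] [Module Ω V] [FiniteDimensional Ω V]
    {ρ : Representation Ω G P} {σ : Representation Ω G V} (hσ : Irr' σ)
    (hc : ∀ S ∈ Hm ρ ρ, ∀ T ∈ Hm ρ ρ, S ∘ₗ T = T ∘ₗ S) :
    Module.finrank Ω (Hm ρ σ) ≤ 1 := by
  by_cases h0 : Hm ρ σ = ⊥
  · rw [h0, finrank_bot]; exact Nat.zero_le _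
  obtain ⟨f, hf, hf0⟩ := Submodule.exists_mem_ne_zero_of_ne_bot h0
  refine finrank_le_one (⟨f, hf⟩ : Hm ρ σ) ?_
  rintro ⟨f2, hf2⟩
  have hs := hm_surj hσ hf hf0
  obtain ⟨s0, hs0⟩ := LinearMap.exists_rightInverse_of_surjective f (LinearMap.range_eq_top.2 hs)
  have hN : (Fintype.card G : Ω) ≠ 0 := Nat.cast_ne_zero.2 Fintype.card_pos.ne'
  set s : V →ₗ[Ω] P := (Fintype.card G : Ω)⁻¹ • ∑ g : G, ρ g ∘ₗ s0 ∘ₗ σ g⁻¹ with hsdef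
  have hsm : s ∈ Hm σ ρ := Submodule.smul_mem _ _ (avg_mem σ ρ s0)
  have hfs : ∀ v, f (s v) = v := by
    intro v
    rw [hsdef, LinearMap.smul_apply, map_smul, LinearMap.sum_apply, map_sum]
    have : ∀ g : G, f ((ρ g ∘ₗ s0 ∘ₗ σ g⁻¹) v) = v := by
      intro g
      rw [LinearMap.comp_apply, LinearMap.comp_apply, hf]
      have h1 : f (s0 (σ g⁻¹ v)) = σ g⁻¹ v := LinearMap.congr_fun hs0 _
      rw [h1, ← Module.End.mul_apply, ← map_mul]; simp
    rw [Finset.sum_congr rfl (fun g _ => this g), Finset.sum_const, Finset.card_univ,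
      ← Nat.cast_smul_eq_nsmul Ω, smul_smul, inv_mul_cancel₀ hN, one_smul]
  obtain ⟨c, hcs⟩ := schur_scalar hσ (f2 ∘ₗ s) (by
    intro g v
    rw [LinearMap.comp_apply, LinearMap.comp_apply, hsm, hf2])
  refine ⟨c, ?_⟩
  apply Subtype.ext
  apply LinearMap.ext
  intro x
  change c • f x = f2 x
  have h1 : s ∘ₗ f ∈ Hm ρ ρ := by
    intro g v; rw [LinearMap.comp_apply, LinearMap.comp_apply, hf, hsm]
  have h2 : s ∘ₗ f2 ∈ Hm ρ ρ := by
    intro g v; rw [LinearMap.comp_apply, LinearMap.comp_apply, hf2, hsm]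
  have h3 := LinearMap.congr_fun (hc _ h1 _ h2) x
  simp only [LinearMap.comp_apply] at h3 hcs
  rw [hfs, hcs, map_smul] at h3
  have h4 := congrArg f h3
  rw [map_smul, hfs, hfs] at h4
  exact h4.symm

/-- multiplicity one somewhere forces a commutative endomorphism ring -/
lemma comm_of_one {k Ω G P V : Type} [Field k] [Field Ω] [Algebra k Ω] [Group G]
    [AddCommGroup P] [Module k P] [FiniteDimensional k P] [AddCommGroup V] [Module Ω V] 
    {ρ : Representation k G P} (hρ : Irr' ρ) {σ : Representation Ω G V}
    (h1 : Module.finrank Ω (Hm (bc Ω ρ) σ) = 1) :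
    ∀ S ∈ Hm ρ ρ, ∀ T ∈ Hm ρ ρ, S ∘ₗ T = T ∘ₗ S := by
  intro S hS T hT
  by_contra hne
  obtain ⟨⟨f, hf⟩, hf0, hgen⟩ := finrank_eq_one_iff'.1 h1
  have hf0 : f ≠ 0 := fun h => hf0 (Subtype.ext h)
  have hbc : ∀ S ∈ Hm ρ ρ, ∃ c : Ω, f ∘ₗ S.baseChange Ω = c • f := by
    intro S hS
    have : f ∘ₗ S.baseChange Ω ∈ Hm (bc Ω ρ) σ := by
      intro g v
      rw [LinearMap.comp_apply, LinearMap.comp_apply, ← hf]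
      congr 1
      induction v using TensorProduct.induction_on with
      | zero => simp
      | add a b ha hb => simp only [map_add, ha, hb]
      | tmul a v => rw [bc_tmul, LinearMap.baseChange_tmul, LinearMap.baseChange_tmul, bc_tmul, hS]
    obtain ⟨c, hc⟩ := hgen ⟨_, this⟩
    exact ⟨c, (congrArg Subtype.val hc).symm⟩
  obtain ⟨c, hc⟩ := hbc S hS
  obtain ⟨d, hd⟩ := hbc T hT
  set D := S ∘ₗ T - T ∘ₗ S with hDdef
  have hD0 : D ≠ 0 := sub_ne_zero.2 hne
  have hDm : D ∈ Hm ρ ρ := by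
    apply Submodule.sub_mem
    · intro g v; rw [LinearMap.comp_apply, LinearMap.comp_apply, hT, hS]
    · intro g v; rw [LinearMap.comp_apply, LinearMap.comp_apply, hS, hT]
  have hsurj := hm_surj hρ hDm hD0
  have hfD : f ∘ₗ D.baseChange Ω = 0 := by
    rw [hDdef, LinearMap.baseChange_sub, LinearMap.comp_sub, LinearMap.baseChange_comp, LinearMap.baseChange_comp,
      ← LinearMap.comp_assoc, ← LinearMap.comp_assoc, hc, hd, LinearMap.smul_comp, LinearMap.smul_comp, hc, hd,
      smul_smul, smul_smul, mul_comm, sub_self]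
  apply hf0
  apply LinearMap.ext
  intro x
  change f x = 0
  induction x using TensorProduct.induction_on with
  | zero => simp
  | add a b ha hb => rw [map_add, ha, hb, add_zero]
  | tmul a v =>
    obtain ⟨w, rfl⟩ := hsurj v
    exact LinearMap.congr_fun hfD (TensorProduct.tmul k a w)
lemma irr_irr' {k G : Type} [Field k] [Group G] {V : FDRep k G} (h : IsIrr V) : Irr' V.ρ := h

lemma fix_ne_bot {Ω G V : Type} [Field Ω] [Group G] [AddCommGroup V] [Module Ω V]
    {ρ : Representation Ω G V} {K : Subgroup G} (h : 0 < Module.finrank Ω (fixK ρ K)) : fixK ρ K ≠ ⊥ := by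
  intro hb; rw [hb, finrank_bot] at h; exact absurd h (lt_irrefl _)

/-- the key bound -/
lemma mult_key {p : ℕ} (hp : p.Prime) {G k L : Type} [Group G] [Fintype G] (hG : IsPGroup p G)
    [Field k] [CharZero k] [Field L] [Algebra k L] (ψ : FDRep k G) (hψ : IsIrr ψ)
    (χ : FDRep L G) (m : ℕ) (hχ : IsIrr χ) (hm : CharMult χ.character (fun g => algebraMap k L (ψ.character g)) m) :
    ∃ (V : Type) (_ : AddCommGroup V) (_ : Module (AlgebraicClosure L) V) (_ : FiniteDimensional (AlgebraicClosure L) V)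
      (σ : Representation (AlgebraicClosure L) G V), Irr' σ ∧
      m ≤ Module.finrank (AlgebraicClosure L) (Hm (bc (AlgebraicClosure L) ψ.ρ) σ) := by
  have hL : CharZero L := charZero_of_injective_algebraMap (algebraMap k L).injective
  have hΩ : CharZero (AlgebraicClosure L) :=
    charZero_of_injective_algebraMap (algebraMap L (AlgebraicClosure L)).injective
  obtain ⟨W, hW, -⟩ := hm
  have hnt : Nontrivial χ := hχ.1
  have hnt2 : Nontrivial (TensorProduct L (AlgebraicClosure L) χ) := inferInstance
  obtain ⟨U, σ, hσ, hmem, h0⟩ := exists_quot (bc (AlgebraicClosure L) χ.ρ)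
  refine ⟨_, _, _, inferInstance, σ, hσ, ?_⟩
  have h1 := hd_add (bc (AlgebraicClosure L) ψ.ρ) (bc (AlgebraicClosure L) χ.ρ) (bc (AlgebraicClosure L) W.ρ) σ m (by
    intro g
    rw [bc_char, bc_char, bc_char]
    have h2 := congrFun hW g
    have h3 := congrArg (algebraMap L (AlgebraicClosure L)) h2
    rw [← IsScalarTower.algebraMap_apply] at h3
    refine h3.trans ?_
    simp [FDRep.character])
  have h2 : 0 < Module.finrank (AlgebraicClosure L) (Hm (bc (AlgebraicClosure L) χ.ρ) σ) := by
    have : Nontrivial (Hm (bc (AlgebraicClosure L) χ.ρ) σ) :=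
      ⟨⟨_, hmem⟩, 0, fun h => h0 (congrArg Subtype.val h)⟩
    exact Module.finrank_pos (R := AlgebraicClosure L) (M := Hm (bc (AlgebraicClosure L) χ.ρ) σ)
  rw [h1]
  exact (Nat.le_mul_of_pos_right m h2).trans (Nat.le_add_right _ _)


/-- **Schilling's Theorem for `p`-groups.** Let `ψ` be a `𝕂G`-irrep and `𝕃/𝕂` a field
extension. Every irreducible `𝕃G`-constituent of `𝕃 ⊗_𝕂 ψ` has multiplicity at most `2`;
and if some constituent has multiplicity `2`, then any complex irrep quasiconjugate to
`ψ` has Frobenius–Schur indicator `-1`. -/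
theorem schilling_theorem (p : ℕ) (hp : p.Prime)
    (G : Type) [Group G] [Fintype G] (hG : IsPGroup p G)
    (k : Type) [Field k] [CharZero k] (L : Type) [Field L] [Algebra k L]
    (ψ : FDRep k G) (hψ : IsIrr ψ) :
    (∀ (χ : FDRep L G) (m : ℕ), IsIrr χ →
        CharMult χ.character (fun g => algebraMap k L (ψ.character g)) m → m ≤ 2) ∧
    ((∃ χ : FDRep L G, IsIrr χ ∧
          CharMult χ.character (fun g => algebraMap k L (ψ.character g)) 2) →
      ∀ ψc : FDRep ℂ G, IsIrr ψc → Quasiconj ψ ψc →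
        (Fintype.card G : ℂ)⁻¹ * ∑ g : G, ψc.character (g * g) = -1) := by
  constructor
  · intro χ m hχ hm
    have hL : CharZero L := charZero_of_injective_algebraMap (algebraMap k L).injective
    have hΩ : CharZero (AlgebraicClosure L) :=
      charZero_of_injective_algebraMap (algebraMap L (AlgebraicClosure L)).injective
    obtain ⟨V, _, _, _, σ, hσ, hle⟩ := mult_key hp hG ψ hψ χ m hχ hm
    obtain ⟨K, hK⟩ := star_thm hp _ G V hG rfl σ hσ
    have hpos : fixK σ K ≠ ⊥ := fix_ne_bot (by omega)
    have h1 := hd_le (irr_irr' hψ) hσ K hpos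
    omega
  · rintro ⟨χ, hχ, hm⟩ ψc hψc ⟨θ, ⟨hθ, W1, hW1⟩, -, W2, hW2⟩
    have hL : CharZero L := charZero_of_injective_algebraMap (algebraMap k L).injective
    have hΩ : CharZero (AlgebraicClosure L) :=
      charZero_of_injective_algebraMap (algebraMap L (AlgebraicClosure L)).injective
    obtain ⟨V, _, _, _, σ, hσ, hle⟩ := mult_key hp hG ψ hψ χ 2 hχ hm
    obtain ⟨K, hK⟩ := star_thm hp _ G ψc hG rfl ψc.ρ hψc
    have hN : (Fintype.card G : ℂ) ≠ 0 := Nat.cast_ne_zero.2 Fintype.card_pos.ne'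
    rcases hK with hK | ⟨-, -, hK⟩
    · exfalso
      have hle1 := hd_le (irr_irr' hθ) (irr_irr' hψc) K (fix_ne_bot (by omega))
      have h1 := hd_add (bc ℂ θ.ρ) ψc.ρ W2.ρ ψc.ρ 1 (by
        intro g
        rw [bc_char]
        refine (congrFun hW2 g).trans ?_
        simp [FDRep.character])
      have h2 : 0 < Module.finrank ℂ (Hm ψc.ρ ψc.ρ) := by
        have hnt : Nontrivial ψc := hψc.1
        obtain ⟨v, hv⟩ := exists_ne (0 : ↑ψc)
        have : Nontrivial (Hm ψc.ρ ψc.ρ) :=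
          ⟨⟨LinearMap.id, fun _ _ => rfl⟩, 0, fun h => hv (LinearMap.congr_fun (congrArg Subtype.val h) v)⟩
        exact Module.finrank_pos
      have hD := comm_of_one (irr_irr' hθ) (σ := ψc.ρ) (Ω := ℂ) (by omega)
      have h3 := hd_le_one hσ (fun S hS T hT => end_comm (Ω := AlgebraicClosure L) θ.ρ hD S T hS hT)
      have h4 := hd_add (bc (AlgebraicClosure L) θ.ρ) (bc (AlgebraicClosure L) ψ.ρ)
        (bc (AlgebraicClosure L) W1.ρ) σ 1 (by
        intro g
        rw [bc_char, bc_char, bc_char]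
        have h5 := congrArg (algebraMap k (AlgebraicClosure L)) (congrFun hW1 g)
        simp only [FDRep.character, Pi.add_apply, map_add, eq_ratCast, map_ratCast] at h5
        simp only [eq_ratCast, Nat.cast_one, one_mul]
        exact h5)
      omega
    · have : ∑ g : G, ψc.character (g * g) = -(Fintype.card G : ℂ) := hK
      rw [this, mul_neg, inv_mul_cancel₀ hN]

end Genotype
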